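/- Let $M_n$ be the $n\times n$ real symmetric matrix with entries $M_n(j,k) = \frac{1}{\sqrt{2\pi}}\,\frac{\Gamma(j+k-3/2)}{\sqrt{\Gamma(2j-1)\Gamma(2k-1)}}$ for $1\le j,k\le n$, where $\Gamma$ is the real Gamma function. Then $\lim_{n\to\infty} \frac{1}{\sqrt{2n}} \log \det(I_n - M_n) = -\frac{1}{\sqrt{2\pi}}\,\zeta(3/2)$, where $\zeta$ is the Riemann zeta function. -/

import Mathlib

/-- The `n × n` real symmetric matrix with entries
`M_n(j,k) = Γ(j+k-3/2) / (√(2π) √(Γ(2j-1) Γ(2k-1)))` for `1 ≤ j,k ≤ n`. -/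
noncomputable def ginibreM (n : ℕ) : Matrix (Fin n) (Fin n) ℝ :=
  Matrix.of fun j k =>
    (1 / Real.sqrt (2 * Real.pi)) *
      Real.Gamma (((j : ℕ) + 1 : ℝ) + ((k : ℕ) + 1 : ℝ) - 3 / 2) /
        Real.sqrt (Real.Gamma (2 * ((j : ℕ) + 1 : ℝ) - 1) *
          Real.Gamma (2 * ((k : ℕ) + 1 : ℝ) - 1))

open Filter Topology MeasureTheory

/-- The normalized central binomial coefficient `4⁻ⁿ (2n choose n)`. -/
noncomputable def centralCoeff (n : ℕ) : ℝ := (n.centralBinom : ℝ) / 4 ^ n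

lemma centralCoeff_zero : centralCoeff 0 = 1 := by simp [centralCoeff]

lemma centralCoeff_pos (n : ℕ) : 0 < centralCoeff n := by
  have := n.centralBinom_pos
  unfold centralCoeff
  positivity

lemma centralCoeff_succ (n : ℕ) :
    (2 * n + 2) * centralCoeff (n + 1) = (2 * n + 1) * centralCoeff n := by
  have h : ((n : ℝ) + 1) * ((n + 1).centralBinom : ℝ) = 2 * (2 * n + 1) * (n.centralBinom : ℝ) := by
    exact_mod_cast n.succ_mul_centralBinom_succ
  unfold centralCoeff
  rw [pow_succ]
  field_simp
  linarith

lemma centralCoeff_sq_le (n : ℕ) : centralCoeff n ^ 2 ≤ 1 / (n + 1) := by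
  induction n with
  | zero => simp [centralCoeff_zero]
  | succ n ih =>
    have h := centralCoeff_succ n
    have h1 : centralCoeff (n + 1) = (2 * n + 1) / (2 * n + 2) * centralCoeff n := by
      field_simp
      linarith
    rw [h1, mul_pow]
    calc ((2 * (n : ℝ) + 1) / (2 * n + 2)) ^ 2 * centralCoeff n ^ 2
        ≤ ((2 * (n : ℝ) + 1) / (2 * n + 2)) ^ 2 * (1 / (n + 1)) := by gcongr
      _ ≤ 1 / (((n + 1 : ℕ) : ℝ) + 1) := by
        push_cast
        rw [div_pow, div_mul_div_comm, div_le_div_iff₀ (by positivity) (by positivity)]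
        have : (0 : ℝ) ≤ n := n.cast_nonneg
        nlinarith

lemma centralCoeff_le_one (n : ℕ) : centralCoeff n ≤ 1 := by
  have h := centralCoeff_sq_le n
  have h2 : (1 : ℝ) / (n + 1) ≤ 1 := by
    rw [div_le_one (by positivity)]
    simp
  nlinarith [centralCoeff_pos n]

lemma sum_range_centralCoeff (n : ℕ) :
    ∑ i ∈ Finset.range n, centralCoeff i = 2 * n * centralCoeff n := by
  induction n with
  | zero => simp
  | succ n ih =>
    have h := centralCoeff_succ n
    rw [Finset.sum_range_succ, ih]
    push_cast
    linarith

lemma sqrt_mul_centralCoeff_eq {n : ℕ} (hn : n ≠ 0) :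
    √n * centralCoeff n = Stirling.stirlingSeq (2 * n) / Stirling.stirlingSeq n ^ 2 := by
  have hfac : (n.centralBinom : ℝ) * (n.factorial : ℝ) ^ 2 = ((2 * n).factorial : ℝ) := by
    have := Nat.choose_mul_factorial_mul_factorial (show n ≤ 2 * n by omega)
    rw [show 2 * n - n = n by omega] at this
    rw [Nat.centralBinom, ← this]
    push_cast
    ring
  have hn' : (0 : ℝ) < n := by exact_mod_cast Nat.pos_of_ne_zero hn
  have h4 : √(2 * (2 * n : ℕ) : ℝ) = 2 * √n := by
    rw [show (2 * (2 * n : ℕ) : ℝ) = 2 ^ 2 * n by push_cast; ring, Real.sqrt_mul (by positivity),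
      Real.sqrt_sq (by norm_num)]
  have h2 : √(2 * n : ℝ) ^ 2 = 2 * n := Real.sq_sqrt (by positivity)
  have hs : √(n : ℝ) ^ 2 = n := Real.sq_sqrt hn'.le
  have hf : (0 : ℝ) < n.factorial := by exact_mod_cast n.factorial_pos
  have he := Real.exp_pos 1
  unfold Stirling.stirlingSeq centralCoeff
  have hp : ((2 * n : ℕ) / Real.exp 1) ^ (2 * n) = 4 ^ n * ((n / Real.exp 1) ^ n) ^ 2 := by
    rw [← pow_mul, mul_comm n 2, pow_mul, pow_mul, ← mul_pow]
    congr 1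
    push_cast
    ring
  have hq : 0 < ((n : ℝ) / Real.exp 1) ^ n := by positivity
  rw [h4, ← hfac, hp]
  generalize ((n : ℝ) / Real.exp 1) ^ n = q at *
  rw [div_pow, mul_pow, h2]
  have hsq : 0 < √(n : ℝ) := Real.sqrt_pos.2 hn'
  field_simp
  rw [hs, mul_comm]

lemma tendsto_sqrt_mul_centralCoeff :
    Tendsto (fun n : ℕ => √n * centralCoeff n) atTop (𝓝 (1 / √Real.pi)) := by
  have h := Stirling.tendsto_stirlingSeq_sqrt_pi
  have h2 : Tendsto (fun n : ℕ => 2 * n) atTop atTop :=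
    tendsto_id.const_mul_atTop' (by norm_num)
  have hpi : √Real.pi ≠ 0 := (Real.sqrt_pos.2 Real.pi_pos).ne'
  have h3 := (h.comp h2).div (h.pow 2) (pow_ne_zero 2 hpi)
  rw [show √Real.pi / √Real.pi ^ 2 = 1 / √Real.pi by field_simp] at h3
  refine h3.congr' ?_
  filter_upwards [eventually_ne_atTop 0] with n hn
  simp [sqrt_mul_centralCoeff_eq hn]

lemma multichoose_one_half (n : ℕ) : Ring.multichoose (1 / 2 : ℝ) n = centralCoeff n := by
  have key : ∀ n : ℕ, (n.factorial : ℝ) * Ring.multichoose (1 / 2 : ℝ) n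
      = (ascPochhammer ℝ n).eval (1 / 2) := by
    intro n
    have := Ring.factorial_nsmul_multichoose_eq_ascPochhammer (1 / 2 : ℝ) n
    rw [nsmul_eq_mul] at this
    rw [this, Polynomial.ascPochhammer_smeval_eq_eval]
  induction n with
  | zero => simp [centralCoeff_zero]
  | succ n ih =>
    have h1 := key (n + 1)
    rw [ascPochhammer_succ_eval, ← key n, Nat.factorial_succ, ih] at h1
    have h2 := centralCoeff_succ n
    have hf : (0 : ℝ) < n.factorial := by exact_mod_cast n.factorial_pos
    push_cast at h1
    have h3 : ((n : ℝ) + 1) * Ring.multichoose (1 / 2 : ℝ) (n + 1)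
        = centralCoeff n * (1 / 2 + n) := by
      apply mul_left_cancel₀ hf.ne'
      linarith
    apply mul_left_cancel₀ (show (2 * (n : ℝ) + 2) ≠ 0 by positivity)
    linarith

lemma hasSum_centralCoeff_mul_pow {x : ℝ} (hx : |x| < 1) :
    HasSum (fun n => centralCoeff n * x ^ n) (1 / √(1 - x)) := by
  have h := (Real.one_div_one_sub_rpow_hasFPowerSeriesOnBall_zero (1 / 2)).hasSum (y := x)
    (by simpa [enorm_eq_nnnorm, ← NNReal.coe_lt_coe] using hx)
  simp only [FormalMultilinearSeries.ofScalars_apply_eq, ← Ring.multichoose_eq,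
    multichoose_one_half, smul_eq_mul, zero_add, ← Real.sqrt_eq_rpow] at h
  exact h

lemma tendsto_sum_div_sqrt {a : ℕ → ℝ} {l : ℝ}
    (h : Tendsto (fun j : ℕ => √j * a j) atTop (𝓝 l)) :
    Tendsto (fun n : ℕ => (∑ j ∈ Finset.range n, a j) / √n) atTop (𝓝 (2 * l)) := by
  have hpi : 0 < √Real.pi := Real.sqrt_pos.2 Real.pi_pos
  have hb := tendsto_sqrt_mul_centralCoeff
  have hsum : Tendsto (fun n : ℕ => (∑ j ∈ Finset.range n, centralCoeff j) / √n) atTop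
      (𝓝 (2 * (1 / √Real.pi))) := by
    refine (hb.const_mul 2).congr fun n => ?_
    rw [sum_range_centralCoeff]
    rcases eq_or_ne n 0 with rfl | hn
    · simp
    have hn' : (0 : ℝ) < n := by exact_mod_cast Nat.pos_of_ne_zero hn
    have hs : 0 < √(n : ℝ) := Real.sqrt_pos.2 hn'
    field_simp
    rw [Real.sq_sqrt hn'.le, mul_comm]
  have hsqrt : Tendsto (fun n : ℕ => √(n : ℝ)) atTop atTop :=
    Real.tendsto_sqrt_atTop.comp tendsto_natCast_atTop_atTop
  have hdiv : Tendsto (fun n : ℕ => ∑ j ∈ Finset.range n, centralCoeff j) atTop atTop := by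
    have := hsum.pos_mul_atTop (by positivity) hsqrt
    refine this.congr' ?_
    filter_upwards [eventually_gt_atTop 0] with n hn
    have hs : 0 < √(n : ℝ) := Real.sqrt_pos.2 (by exact_mod_cast hn)
    field_simp
  have hlo : (fun j => a j - l * √Real.pi * centralCoeff j) =o[atTop] centralCoeff := by
    rw [Asymptotics.isLittleO_iff_tendsto' (Eventually.of_forall fun x hx =>
      absurd hx (centralCoeff_pos x).ne')]
    have h1 := (h.div hb (by positivity)).sub_const (l * √Real.pi)
    have h2 : l / (1 / √Real.pi) - l * √Real.pi = 0 := by field_simp; ring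
    rw [h2] at h1
    refine h1.congr' ?_
    filter_upwards [eventually_gt_atTop 0] with n hn
    have hs : 0 < √(n : ℝ) := Real.sqrt_pos.2 (by exact_mod_cast hn)
    have := centralCoeff_pos n
    simp only [Pi.div_apply]
    field_simp
  have hS := hlo.sum_range (fun n => (centralCoeff_pos n).le) hdiv
  have h3 := (hS.tendsto_div_nhds_zero.mul hsum).add (hsum.const_mul (l * √Real.pi))
  have h4 : 0 * (2 * (1 / √Real.pi)) + l * √Real.pi * (2 * (1 / √Real.pi)) = 2 * l := by
    field_simp
    ring
  rw [h4] at h3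
  refine h3.congr' ?_
  filter_upwards [eventually_gt_atTop 0] with n hn
  have hs : 0 < √(n : ℝ) := Real.sqrt_pos.2 (by exact_mod_cast hn)
  have hp : 0 < ∑ j ∈ Finset.range n, centralCoeff j :=
    Finset.sum_pos (fun i _ => centralCoeff_pos i) (by simpa using hn.ne')
  rw [Finset.sum_sub_distrib, ← Finset.mul_sum]
  field_simp
  ring

/-- The Taylor coefficients of `((1 - t) (1 + c t))^(-1/2)`. -/
noncomputable def legendreCoeff (c : ℝ) (k : ℕ) : ℝ :=
  ∑ i ∈ Finset.range (k + 1), (centralCoeff i * (-c) ^ i) * centralCoeff (k - i)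

lemma hasSum_legendreCoeff {c t : ℝ} (hc0 : 0 ≤ c) (hc1 : c < 1) (ht : |t| < 1) :
    HasSum (fun k => legendreCoeff c k * t ^ k) (1 / √(1 - t) * (1 / √(1 + c * t))) := by
  have hct : |(-(c * t))| < 1 := by
    rw [abs_neg, abs_mul, abs_of_nonneg hc0]
    nlinarith [abs_nonneg t]
  have h1 := hasSum_centralCoeff_mul_pow ht
  have h2 := hasSum_centralCoeff_mul_pow hct
  have e : ∀ k, (∑ i ∈ Finset.range (k + 1),
      (centralCoeff i * (-(c * t)) ^ i) * (centralCoeff (k - i) * t ^ (k - i)))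
      = legendreCoeff c k * t ^ k := by
    intro k
    rw [legendreCoeff, Finset.sum_mul]
    refine Finset.sum_congr rfl fun i hi => ?_
    have hik : i ≤ k := Nat.lt_succ_iff.1 (Finset.mem_range.1 hi)
    have : t ^ k = t ^ i * t ^ (k - i) := by rw [← pow_add, Nat.add_sub_cancel' hik]
    rw [this, ← neg_mul, mul_pow]
    ring
  have h3 := summable_norm_sum_mul_range_of_summable_norm h2.summable.norm h1.summable.norm
  have h4 := tsum_mul_tsum_eq_tsum_sum_range_of_summable_norm h2.summable.norm h1.summable.norm
  simp_rw [e] at h3 h4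
  rw [h1.tsum_eq, h2.tsum_eq, sub_neg_eq_add, mul_comm] at h4
  rw [h4]
  exact h3.of_norm.hasSum

lemma sqrt_mul_centralCoeff_sub_le {i k : ℕ} (h : i ≤ k) :
    √k * centralCoeff (k - i) ≤ i + 1 := by
  have h1 := centralCoeff_sq_le (k - i)
  have hb := centralCoeff_pos (k - i)
  refine abs_le_of_sq_le_sq' ?_ (by positivity) |>.2
  rw [mul_pow, Real.sq_sqrt (by positivity)]
  obtain ⟨d, rfl⟩ := Nat.exists_eq_add_of_le h
  simp only [Nat.add_sub_cancel_left] at *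
  calc ((i + d : ℕ) : ℝ) * centralCoeff d ^ 2 ≤ ((i + d : ℕ) : ℝ) * (1 / (d + 1)) := by gcongr
    _ ≤ (i + 1) ^ 2 := by
      rw [mul_one_div, div_le_iff₀ (by positivity)]
      push_cast
      have : (0 : ℝ) ≤ i := i.cast_nonneg
      have : (0 : ℝ) ≤ d := d.cast_nonneg
      nlinarith [mul_nonneg ‹(0 : ℝ) ≤ i› ‹(0 : ℝ) ≤ d›]

lemma tendsto_sqrt_mul_legendreCoeff {c : ℝ} (hc0 : 0 ≤ c) (hc1 : c < 1) :
    Tendsto (fun k : ℕ => √k * legendreCoeff c k) atTop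
      (𝓝 (1 / √Real.pi * (1 / √(1 + c)))) := by
  have hct : |(-c)| < 1 := by rwa [abs_neg, abs_of_nonneg hc0]
  have h2 := (hasSum_centralCoeff_mul_pow hct).mul_left (1 / √Real.pi)
  rw [sub_neg_eq_add] at h2
  rw [← h2.tsum_eq]
  let F : ℕ → ℕ → ℝ := fun k i =>
    if i ≤ k then (√k * centralCoeff (k - i)) * (centralCoeff i * (-c) ^ i) else 0
  have hF : ∀ k : ℕ, √k * legendreCoeff c k = ∑' i, F k i := by
    intro k
    rw [tsum_eq_sum (s := Finset.range (k + 1)), legendreCoeff, Finset.mul_sum]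
    · refine Finset.sum_congr rfl fun i hi => ?_
      have hik : i ≤ k := Nat.lt_succ_iff.1 (Finset.mem_range.1 hi)
      simp only [F, hik, if_true]
      ring
    · intro i hi
      have hik : ¬ i ≤ k := by simpa [Nat.lt_succ_iff] using hi
      simp [F, hik]
  simp_rw [hF]
  refine tendsto_tsum_of_dominated_convergence (bound := fun i : ℕ => ((i : ℝ) + 1) * c ^ i)
    ?_ ?_ ?_
  · have hcn : ‖c‖ < 1 := by rwa [Real.norm_eq_abs, abs_of_nonneg hc0]
    have s1 := summable_pow_mul_geometric_of_norm_lt_one 1 hcn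
    have s2 := summable_geometric_of_norm_lt_one hcn
    refine (s1.add s2).congr fun i => ?_
    ring
  · intro i
    refine Tendsto.mul ?_ tendsto_const_nhds |>.congr' (f₁ := fun k : ℕ =>
      (√k * centralCoeff (k - i)) * (centralCoeff i * (-c) ^ i)) ?_
    · rw [← tendsto_add_atTop_iff_nat i]
      simp only [Nat.add_sub_cancel]
      have h1 := tendsto_sqrt_mul_centralCoeff
      have h3 : Tendsto (fun n : ℕ => √(((n + i : ℕ) : ℝ) / (n : ℝ))) atTop (𝓝 1) := by
        have : Tendsto (fun n : ℕ => ((n + i : ℕ) : ℝ) / (n : ℝ)) atTop (𝓝 1) := by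
          have h5 := (tendsto_const_div_atTop_nhds_zero_nat (i : ℝ)).const_add 1
          rw [add_zero] at h5
          refine h5.congr' ?_
          filter_upwards [eventually_gt_atTop 0] with n hn
          have : (0 : ℝ) < n := by exact_mod_cast hn
          push_cast
          field_simp
        simpa using this.sqrt
      have h4 := h3.mul h1
      rw [one_mul] at h4
      refine h4.congr' ?_
      filter_upwards [eventually_gt_atTop 0] with n hn
      have hs : 0 < √(n : ℝ) := Real.sqrt_pos.2 (by exact_mod_cast hn)
      rw [Real.sqrt_div (by positivity)]
      field_simp
    · filter_upwards [eventually_ge_atTop i] with k hk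
      simp [F, hk]
  · refine Eventually.of_forall fun k i => ?_
    by_cases hik : i ≤ k
    · simp only [F, hik, if_true]
      have hb := centralCoeff_pos (k - i)
      have hi := centralCoeff_pos i
      rw [norm_mul, norm_mul (centralCoeff i), norm_pow, norm_neg, Real.norm_of_nonneg hc0,
        Real.norm_of_nonneg (by positivity), Real.norm_of_nonneg hi.le]
      gcongr
      · exact sqrt_mul_centralCoeff_sub_le hik
      · exact mul_le_of_le_one_left (by positivity) (centralCoeff_le_one i)
    · simp only [F, hik, if_false, norm_zero]
      positivity

lemma eq_zero_of_hasSum_pow_zero {d : ℕ → ℝ}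
    (h : ∀ z ∈ Set.Ioo (0 : ℝ) 1, HasSum (fun j => d j * z ^ j) 0) : d = 0 := by
  let p := FormalMultilinearSeries.ofScalars ℝ d
  have hr : 0 < p.radius := by
    have h2 := (h (1 / 2) ⟨by norm_num, by norm_num⟩).summable.norm
    have : ((1 / 2 : NNReal) : ENNReal) ≤ p.radius := by
      apply FormalMultilinearSeries.le_radius_of_summable
      refine h2.congr fun n => ?_
      simp [p]
    exact lt_of_lt_of_le (by simp) this
  have hp := (p.hasFPowerSeriesOnBall hr).hasFPowerSeriesAt
  by_contra hd
  have hp0 : p ≠ 0 := by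
    intro h0
    exact hd ((FormalMultilinearSeries.ofScalars_series_eq_zero ℝ).1 h0)
  have hne := hp.locally_ne_zero hp0
  have hmono : ∀ᶠ z in 𝓝[>] (0 : ℝ), p.sum z ≠ 0 :=
    hne.filter_mono (nhdsWithin_mono _ fun z hz => ne_of_gt hz)
  have hz : ∀ᶠ z in 𝓝[>] (0 : ℝ), z ∈ Set.Ioo (0 : ℝ) 1 := Ioo_mem_nhdsGT one_pos
  obtain ⟨z, hz1, hz2⟩ := (hmono.and hz).exists
  apply hz1
  rw [FormalMultilinearSeries.sum]
  simpa [p, FormalMultilinearSeries.ofScalars_apply_eq, mul_comm] using (h z hz2).tsum_eq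

lemma eq_legendreCoeff_of_hasSum {c κ : ℝ} (hc0 : 0 ≤ c) (hc1 : c < 1) {a : ℕ → ℝ}
    (h : ∀ t ∈ Set.Ioo (0 : ℝ) 1, HasSum (fun j => a j * t ^ (2 * j))
      (κ / 2 * (1 / √(1 - t) * (1 / √(1 + c * t)) + 1 / √(1 + t) * (1 / √(1 - c * t))))) (j : ℕ) :
    a j = κ * legendreCoeff c (2 * j) := by
  have key : (fun j => a j - κ * legendreCoeff c (2 * j)) = 0 := by
    apply eq_zero_of_hasSum_pow_zero
    intro z hz
    set t := √z with htdef
    have hz2 : z = t ^ 2 := (Real.sq_sqrt hz.1.le).symm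
    have ht : t ∈ Set.Ioo (0 : ℝ) 1 :=
      ⟨Real.sqrt_pos.2 hz.1, by rw [htdef, Real.sqrt_lt' one_pos]; simpa using hz.2⟩
    have habs : |t| < 1 := by rw [abs_of_pos ht.1]; exact ht.2
    have h1 := hasSum_legendreCoeff hc0 hc1 habs
    have h2 := hasSum_legendreCoeff (t := -t) hc0 hc1 (by rwa [abs_neg])
    have h3 := (h1.add h2).mul_left (κ / 2)
    rw [sub_neg_eq_add, mul_neg, ← sub_eq_add_neg] at h3
    have hodd : ∀ k ∉ Set.range (fun j : ℕ => 2 * j),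
        κ / 2 * (legendreCoeff c k * t ^ k + legendreCoeff c k * (-t) ^ k) = 0 := by
      intro k hk
      have : Odd k := by
        rw [← Nat.not_even_iff_odd]
        rintro ⟨r, rfl⟩
        exact hk ⟨r, by simp only; ring⟩
      rw [this.neg_pow]
      ring
    have hinj : Function.Injective (fun j : ℕ => 2 * j) := fun a b hab => by
      simpa using hab
    have h4 := (hinj.hasSum_iff hodd).2 h3
    have h5 := (h t ht).sub h4
    rw [sub_self] at h5
    refine h5.congr_fun fun j => ?_
    simp only [Function.comp_apply]
    rw [(even_two_mul j).neg_pow, hz2, ← pow_mul]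
    ring
  have := congrFun key j
  simp only [Pi.zero_apply] at this
  linarith

lemma tendsto_sum_div_sqrt_of_hasSum {c κ : ℝ} (hc0 : 0 ≤ c) (hc1 : c < 1) {a : ℕ → ℝ}
    (h : ∀ t ∈ Set.Ioo (0 : ℝ) 1, HasSum (fun j => a j * t ^ (2 * j))
      (κ / 2 * (1 / √(1 - t) * (1 / √(1 + c * t)) + 1 / √(1 + t) * (1 / √(1 - c * t))))) :
    Tendsto (fun n : ℕ => (∑ j ∈ Finset.range n, a j) / √n) atTop
      (𝓝 (2 * (κ / √2 * (1 / √Real.pi * (1 / √(1 + c)))))) := by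
  apply tendsto_sum_div_sqrt
  have h2 : Tendsto (fun n : ℕ => 2 * n) atTop atTop :=
    tendsto_id.const_mul_atTop' (by norm_num)
  refine (((tendsto_sqrt_mul_legendreCoeff hc0 hc1).comp h2).const_mul (κ / √2)).congr fun j => ?_
  rw [eq_legendreCoeff_of_hasSum hc0 hc1 h]
  simp only [Function.comp_apply]
  push_cast
  rw [Real.sqrt_mul (by norm_num)]
  have : 0 < √(2 : ℝ) := by positivity
  field_simp

lemma lintegral_exp_quadratic {a : ℝ} (ha : 0 < a) (b : ℝ) :
    ∫⁻ y : ℝ, ENNReal.ofReal (Real.exp (-a * y ^ 2 + b * y))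
      = ENNReal.ofReal (√(Real.pi / a) * Real.exp (b ^ 2 / (4 * a))) := by
  have h1 : ∀ y : ℝ, ENNReal.ofReal (Real.exp (-a * y ^ 2 + b * y))
      = ENNReal.ofReal (Real.exp (-a * (y - b / (2 * a)) ^ 2))
        * ENNReal.ofReal (Real.exp (b ^ 2 / (4 * a))) := by
    intro y
    rw [← ENNReal.ofReal_mul (Real.exp_pos _).le, ← Real.exp_add]
    congr 2
    field_simp
    ring
  simp_rw [h1]
  rw [lintegral_mul_const _ (by fun_prop),
    lintegral_sub_right_eq_self (fun y : ℝ => ENNReal.ofReal (Real.exp (-a * y ^ 2))),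
    ← ofReal_integral_eq_lintegral_ofReal (integrable_exp_neg_mul_sq ha)
      (Eventually.of_forall fun y => (Real.exp_pos _).le),
    integral_gaussian, ENNReal.ofReal_mul (Real.sqrt_nonneg _)]

/-- The centred Gaussian density of variance `s`. -/
noncomputable def heatKernel (s u : ℝ) : ℝ := 1 / √(2 * Real.pi * s) * Real.exp (-u ^ 2 / (2 * s))

lemma heatKernel_nonneg (s u : ℝ) : 0 ≤ heatKernel s u := by
  unfold heatKernel; positivity

lemma heatKernel_neg (s u : ℝ) : heatKernel s (-u) = heatKernel s u := by
  simp [heatKernel]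

@[fun_prop]
lemma continuous_heatKernel (s : ℝ) : Continuous (heatKernel s) := by
  unfold heatKernel; fun_prop

lemma lintegral_heatKernel_mul_heatKernel {s : ℝ} (hs : 0 < s) (x y : ℝ) :
    ∫⁻ z : ℝ, ENNReal.ofReal (heatKernel 1 (x - z)) * ENNReal.ofReal (heatKernel s (z - y))
      = ENNReal.ofReal (heatKernel (s + 1) (x - y)) := by
  have hpi := Real.pi_pos
  have h1 : ∀ z : ℝ,
      ENNReal.ofReal (heatKernel 1 (x - z)) * ENNReal.ofReal (heatKernel s (z - y))
      = ENNReal.ofReal (1 / √(2 * Real.pi * 1) * (1 / √(2 * Real.pi * s))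
          * Real.exp (-x ^ 2 / 2 - y ^ 2 / (2 * s)))
        * ENNReal.ofReal (Real.exp (-((1 + 1 / s) / 2) * z ^ 2 + (x + y / s) * z)) := by
    intro z
    rw [← ENNReal.ofReal_mul (heatKernel_nonneg _ _), ← ENNReal.ofReal_mul (by positivity),
      heatKernel, heatKernel, mul_mul_mul_comm, mul_assoc (1 / √(2 * Real.pi * 1) * _),
      ← Real.exp_add, ← Real.exp_add]
    congr 3
    field_simp
    ring
  simp_rw [h1]
  rw [lintegral_const_mul _ (by fun_prop), lintegral_exp_quadratic (by positivity),
    ← ENNReal.ofReal_mul (by positivity), heatKernel]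
  congr 1
  have e1 : Real.exp (-x ^ 2 / 2 - y ^ 2 / (2 * s))
      * Real.exp ((x + y / s) ^ 2 / (4 * ((1 + 1 / s) / 2)))
      = Real.exp (-(x - y) ^ 2 / (2 * (s + 1))) := by
    rw [← Real.exp_add]
    congr 1
    field_simp
    ring
  have e2 : 1 / √(2 * Real.pi * 1) * (1 / √(2 * Real.pi * s)) * √(Real.pi / ((1 + 1 / s) / 2))
      = 1 / √(2 * Real.pi * (s + 1)) := by
    rw [← Real.sqrt_one, ← Real.sqrt_div (by positivity), ← Real.sqrt_div (by positivity),
      ← Real.sqrt_div (by positivity), ← Real.sqrt_mul (by positivity),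
      ← Real.sqrt_mul (by positivity), Real.sqrt_one]
    congr 1
    field_simp
  rw [← e1, ← e2]
  ring

lemma lintegral_lintegral_exp_quadratic {A B : ℝ} (hB : |B| < A) :
    ∫⁻ x : ℝ, ∫⁻ y : ℝ, ENNReal.ofReal (Real.exp (-(A / 2) * (x ^ 2 + y ^ 2) + B * (x * y)))
      = ENNReal.ofReal (2 * Real.pi / √(A ^ 2 - B ^ 2)) := by
  have hA : 0 < A := (abs_nonneg B).trans_lt hB
  have hpi := Real.pi_pos
  have hAB : 0 < A ^ 2 - B ^ 2 := by
    have := sq_lt_sq' (by linarith [neg_abs_le B, abs_nonneg B]) hB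
    rw [sq_abs] at this
    linarith
  have h1 : ∀ x : ℝ,
      ∫⁻ y : ℝ, ENNReal.ofReal (Real.exp (-(A / 2) * (x ^ 2 + y ^ 2) + B * (x * y)))
      = ENNReal.ofReal √(Real.pi / (A / 2))
        * ENNReal.ofReal (Real.exp (-((A ^ 2 - B ^ 2) / (2 * A)) * x ^ 2 + 0 * x)) := by
    intro x
    have h2 : ∀ y : ℝ, ENNReal.ofReal (Real.exp (-(A / 2) * (x ^ 2 + y ^ 2) + B * (x * y)))
        = ENNReal.ofReal (Real.exp (-(A / 2) * x ^ 2))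
          * ENNReal.ofReal (Real.exp (-(A / 2) * y ^ 2 + (B * x) * y)) := by
      intro y
      rw [← ENNReal.ofReal_mul (by positivity), ← Real.exp_add]
      congr 2
      ring
    simp_rw [h2]
    rw [lintegral_const_mul _ (by fun_prop), lintegral_exp_quadratic (by positivity),
      ← ENNReal.ofReal_mul (by positivity), ← ENNReal.ofReal_mul (by positivity), mul_left_comm,
      ← Real.exp_add]
    congr 3
    field_simp
    ring
  simp_rw [h1]
  rw [lintegral_const_mul _ (by fun_prop), lintegral_exp_quadratic (by positivity),
    ← ENNReal.ofReal_mul (by positivity)]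
  congr 1
  rw [← mul_assoc, ← Real.sqrt_mul (by positivity), zero_pow two_ne_zero, zero_div, Real.exp_zero,
    mul_one, show Real.pi / (A / 2) * (Real.pi / ((A ^ 2 - B ^ 2) / (2 * A)))
      = (2 * Real.pi) ^ 2 / (A ^ 2 - B ^ 2) by field_simp,
    Real.sqrt_div (by positivity), Real.sqrt_sq (by positivity)]

/-- The normalized monomials `x ^ (2j) / √((2j)!)`, weighted by `exp (-x² / 2)`. -/
noncomputable def evenState (j : ℕ) (x : ℝ) : ℝ :=
  x ^ (2 * j) / √((2 * j).factorial : ℝ) * Real.exp (-x ^ 2 / 2)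

lemma evenState_nonneg (j : ℕ) (x : ℝ) : 0 ≤ evenState j x := by
  have : 0 ≤ x ^ (2 * j) := (even_two_mul j).pow_nonneg x
  unfold evenState; positivity

lemma evenState_neg (j : ℕ) (x : ℝ) : evenState j (-x) = evenState j x := by
  simp [evenState, (even_two_mul j).neg_pow]

@[fun_prop]
lemma continuous_evenState (j : ℕ) : Continuous (evenState j) := by
  unfold evenState; fun_prop

lemma hasSum_evenState (t x y : ℝ) :
    HasSum (fun j => evenState j x * evenState j y * t ^ (2 * j))
      (Real.exp (-(x ^ 2 + y ^ 2) / 2) * Real.cosh (t * (x * y))) := by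
  refine ((Real.hasSum_cosh (t * (x * y))).mul_left _).congr_fun fun j => ?_
  have hf : (0 : ℝ) < ((2 * j).factorial : ℝ) := by exact_mod_cast Nat.factorial_pos _
  have hs : √((2 * j).factorial : ℝ) ^ 2 = (2 * j).factorial := Real.sq_sqrt hf.le
  have he : Real.exp (-(x ^ 2 + y ^ 2) / 2) = Real.exp (-x ^ 2 / 2) * Real.exp (-y ^ 2 / 2) := by
    rw [← Real.exp_add]
    congr 1
    ring
  unfold evenState
  rw [he, mul_pow, mul_pow]
  field_simp
  rw [hs]
  ring

lemma tsum_ofReal_evenState {t : ℝ} (x y : ℝ) :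
    ∑' j, ENNReal.ofReal (evenState j x * evenState j y * t ^ (2 * j))
      = ENNReal.ofReal (Real.exp (-(x ^ 2 + y ^ 2) / 2) * Real.cosh (t * (x * y))) := by
  rw [← (hasSum_evenState t x y).tsum_eq, ENNReal.ofReal_tsum_of_nonneg _
    (hasSum_evenState t x y).summable]
  intro j
  exact mul_nonneg (mul_nonneg (evenState_nonneg _ _) (evenState_nonneg _ _))
    ((even_two_mul j).pow_nonneg t)

/-- The entries of `ginibreM`, with row and column indices in `ℕ` starting from `0`. -/
noncomputable def ginibreEntry (j k : ℕ) : ℝ :=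
  (1 / √(2 * Real.pi)) * Real.Gamma ((j + 1 : ℝ) + (k + 1 : ℝ) - 3 / 2) /
    √(Real.Gamma (2 * (j + 1 : ℝ) - 1) * Real.Gamma (2 * (k + 1 : ℝ) - 1))

lemma Gamma_two_mul_add_one_sub_one (j : ℕ) :
    Real.Gamma (2 * (j + 1 : ℝ) - 1) = ((2 * j).factorial : ℝ) := by
  rw [← Real.Gamma_nat_eq_factorial]
  congr 1
  push_cast
  ring

lemma ginibreEntry_eq (j k : ℕ) :
    ginibreEntry j k = 1 / √(2 * Real.pi) *
      (Real.Gamma ((j + k : ℕ) + 1 / 2) /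
        (√((2 * j).factorial : ℝ) * √((2 * k).factorial : ℝ))) := by
  rw [ginibreEntry, Gamma_two_mul_add_one_sub_one, Gamma_two_mul_add_one_sub_one,
    Real.sqrt_mul (x := ((2 * j).factorial : ℝ)) (by positivity), mul_div_assoc]
  congr 3
  push_cast
  ring

lemma ginibreEntry_nonneg (j k : ℕ) : 0 ≤ ginibreEntry j k := by
  rw [ginibreEntry_eq]
  have : 0 < Real.Gamma ((j + k : ℕ) + 1 / 2) := Real.Gamma_pos_of_pos (by positivity)
  positivity

lemma ginibreEntry_comm (j k : ℕ) : ginibreEntry j k = ginibreEntry k j := by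
  rw [ginibreEntry_eq, ginibreEntry_eq, add_comm j k, mul_comm √((2 * j).factorial : ℝ)]

lemma lintegral_pow_mul_exp (s : ℕ) :
    ∫⁻ x : ℝ, ENNReal.ofReal (x ^ (2 * s) * Real.exp (-x ^ 2))
      = ENNReal.ofReal (Real.Gamma (s + 1 / 2)) := by
  have hint : Integrable fun x : ℝ => x ^ (2 * s) * Real.exp (-x ^ 2) := by
    have := integrable_rpow_mul_exp_neg_mul_sq (b := 1) one_pos (s := ((2 * s : ℕ) : ℝ))
      (by have : (0 : ℝ) ≤ ((2 * s : ℕ) : ℝ) := Nat.cast_nonneg _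
          linarith)
    simpa only [Real.rpow_natCast, neg_mul, one_mul] using this
  rw [← ofReal_integral_eq_lintegral_ofReal hint
    (Eventually.of_forall fun x => mul_nonneg ((even_two_mul s).pow_nonneg x) (Real.exp_pos _).le)]
  congr 1
  have h1 := integral_comp_abs (f := fun x : ℝ => x ^ (2 * s) * Real.exp (-x ^ 2))
  simp only [(even_two_mul s).pow_abs, sq_abs] at h1
  have h2 := integral_rpow_mul_exp_neg_rpow (p := 2) (q := ((2 * s : ℕ) : ℝ)) two_pos
    (by have : (0 : ℝ) ≤ ((2 * s : ℕ) : ℝ) := Nat.cast_nonneg _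
        linarith)
  simp only [Real.rpow_natCast, Real.rpow_two] at h2
  rw [h1, h2]
  push_cast
  rw [← mul_assoc]
  norm_num
  congr 1
  ring

lemma ofReal_ginibreEntry (j k : ℕ) :
    ENNReal.ofReal (ginibreEntry j k) = ENNReal.ofReal (1 / √(2 * Real.pi)) *
      ∫⁻ x : ℝ, ENNReal.ofReal (evenState j x) * ENNReal.ofReal (evenState k x) := by
  have h : ∀ x : ℝ, ENNReal.ofReal (evenState j x) * ENNReal.ofReal (evenState k x)
      = ENNReal.ofReal (1 / (√((2 * j).factorial : ℝ) * √((2 * k).factorial : ℝ)))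
        * ENNReal.ofReal (x ^ (2 * (j + k)) * Real.exp (-x ^ 2)) := by
    intro x
    rw [← ENNReal.ofReal_mul (evenState_nonneg _ _), ← ENNReal.ofReal_mul (by positivity)]
    congr 1
    have he : Real.exp (-x ^ 2) = Real.exp (-x ^ 2 / 2) * Real.exp (-x ^ 2 / 2) := by
      rw [← Real.exp_add]
      congr 1
      ring
    rw [evenState, evenState, he, mul_add 2, pow_add]
    field_simp
  simp_rw [h]
  rw [lintegral_const_mul _ (by fun_prop), lintegral_pow_mul_exp,
    ← ENNReal.ofReal_mul (by positivity), ← ENNReal.ofReal_mul (by positivity), ginibreEntry_eq]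
  congr 2
  ring

/-- The infinite matrix of which the `ginibreM n` are the leading blocks. -/
noncomputable def ginibreKernel (j k : ℕ) : ENNReal := ENNReal.ofReal (ginibreEntry j k)

/-- The powers of the infinite matrix `ginibreKernel`. -/
noncomputable def ginibreKernelPow : ℕ → ℕ → ℕ → ENNReal
  | 0, j, k => if j = k then 1 else 0
  | m + 1, j, k => ∑' l, ginibreKernel j l * ginibreKernelPow m l k

/-- The evolution of `evenState k` under `m` steps of the heat semigroup. -/
noncomputable def heatState : ℕ → ℕ → ℝ → ENNReal
  | 0, k, x => ENNReal.ofReal (evenState k x)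
  | m + 1, k, x => ∫⁻ y : ℝ, ENNReal.ofReal (heatKernel 1 (x - y)) * heatState m k y

@[fun_prop]
lemma measurable_heatState (m k : ℕ) : Measurable (heatState m k) := by
  induction m with
  | zero => exact (continuous_evenState k).measurable.ennreal_ofReal
  | succ m ih =>
    refine Measurable.lintegral_prod_right'
      (f := fun p : ℝ × ℝ => ENNReal.ofReal (heatKernel 1 (p.1 - p.2)) * heatState m k p.2) ?_
    fun_prop

lemma heatState_neg (m k : ℕ) (x : ℝ) : heatState m k (-x) = heatState m k x := by
  induction m generalizing x with
  | zero => simp [heatState, evenState_neg]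
  | succ m ih =>
    unfold heatState
    rw [← lintegral_neg_eq_self]
    refine lintegral_congr fun y => ?_
    rw [ih, ← heatKernel_neg, show -(-x - -y) = x - y by ring]

lemma const_mul_tsum_evenState (x y : ℝ) :
    ENNReal.ofReal (1 / √(2 * Real.pi)) *
        ∑' l, ENNReal.ofReal (evenState l x) * ENNReal.ofReal (evenState l y)
      = 2⁻¹ * (ENNReal.ofReal (heatKernel 1 (x - y)) + ENNReal.ofReal (heatKernel 1 (-x - y))) := by
  have h := tsum_ofReal_evenState (t := 1) x y
  simp only [one_pow, mul_one, one_mul] at h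
  simp_rw [← ENNReal.ofReal_mul (evenState_nonneg _ _)]
  have h2 : (2⁻¹ : ENNReal) = ENNReal.ofReal 2⁻¹ := by
    rw [ENNReal.ofReal_inv_of_pos two_pos, ENNReal.ofReal_ofNat]
  rw [h, h2, ← ENNReal.ofReal_add (heatKernel_nonneg _ _) (heatKernel_nonneg _ _),
    ← ENNReal.ofReal_mul (by positivity), ← ENNReal.ofReal_mul (by positivity)]
  congr 1
  have e1 : Real.exp (-(x - y) ^ 2 / (2 * 1))
      = Real.exp (-(x ^ 2 + y ^ 2) / 2) * Real.exp (x * y) := by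
    rw [← Real.exp_add]; congr 1; ring
  have e2 : Real.exp (-(-x - y) ^ 2 / (2 * 1))
      = Real.exp (-(x ^ 2 + y ^ 2) / 2) * Real.exp (-(x * y)) := by
    rw [← Real.exp_add]; congr 1; ring
  rw [heatKernel, heatKernel, e1, e2, Real.cosh_eq, mul_one]
  ring

lemma ginibreKernelPow_succ_eq (m j k : ℕ) :
    ginibreKernelPow (m + 1) j k = ENNReal.ofReal (1 / √(2 * Real.pi)) *
      ∫⁻ x : ℝ, ENNReal.ofReal (evenState j x) * heatState m k x := by
  induction m generalizing j with
  | zero =>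
    simp only [ginibreKernelPow, mul_ite, mul_one, mul_zero, tsum_ite_eq]
    exact ofReal_ginibreEntry j k
  | succ m ih =>
    set c := ENNReal.ofReal (1 / √(2 * Real.pi)) with hc
    have key : ∀ x : ℝ, heatState (m + 1) k x = c * ∑' l, ENNReal.ofReal (evenState l x) *
        ∫⁻ y : ℝ, ENNReal.ofReal (evenState l y) * heatState m k y := by
      intro x
      have e0 : ∀ l, ENNReal.ofReal (evenState l x) *
            ∫⁻ y : ℝ, ENNReal.ofReal (evenState l y) * heatState m k y
          = ∫⁻ y : ℝ, ENNReal.ofReal (evenState l x) *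
            (ENNReal.ofReal (evenState l y) * heatState m k y) := fun l =>
        (lintegral_const_mul _ (by fun_prop)).symm
      simp_rw [e0]
      rw [← lintegral_tsum (fun l => by fun_prop), ← lintegral_const_mul]
      · have e : ∀ y : ℝ, c * ∑' l, ENNReal.ofReal (evenState l x) *
            (ENNReal.ofReal (evenState l y) * heatState m k y)
            = 2⁻¹ * (ENNReal.ofReal (heatKernel 1 (x - y)) * heatState m k y
              + ENNReal.ofReal (heatKernel 1 (-x - y)) * heatState m k y) := by
          intro y
          simp_rw [← mul_assoc (ENNReal.ofReal (evenState _ x)), ENNReal.tsum_mul_right]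
          rw [← mul_assoc, hc, const_mul_tsum_evenState, mul_assoc, add_mul]
        simp_rw [e]
        rw [lintegral_const_mul _ (by fun_prop), lintegral_add_left (by fun_prop)]
        change heatState (m + 1) k x = 2⁻¹ * (heatState (m + 1) k x + heatState (m + 1) k (-x))
        rw [heatState_neg, ← two_mul, ← mul_assoc,
          ENNReal.inv_mul_cancel two_ne_zero ENNReal.ofNat_ne_top, one_mul]
      · exact Measurable.tsum fun l => by fun_prop
    calc ginibreKernelPow (m + 2) j k
        = ∑' l, ginibreKernel j l * ginibreKernelPow (m + 1) l k := rfl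
      _ = ∑' l, c * (∫⁻ x : ℝ, ENNReal.ofReal (evenState j x) * ENNReal.ofReal (evenState l x)) *
            (c * ∫⁻ y : ℝ, ENNReal.ofReal (evenState l y) * heatState m k y) := by
          simp_rw [ih, ginibreKernel, ofReal_ginibreEntry]
          rfl
      _ = c * ∑' l, ∫⁻ x : ℝ, ENNReal.ofReal (evenState j x) * (c * (ENNReal.ofReal (evenState l x) *
            ∫⁻ y : ℝ, ENNReal.ofReal (evenState l y) * heatState m k y)) := by
          rw [← ENNReal.tsum_mul_left]
          refine tsum_congr fun l => ?_
          rw [mul_assoc, ← lintegral_mul_const _ (by fun_prop)]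
          congr 1
          refine lintegral_congr fun x => ?_
          ring
      _ = c * ∫⁻ x : ℝ, ENNReal.ofReal (evenState j x) * heatState (m + 1) k x := by
          rw [← lintegral_tsum (fun l => by fun_prop)]
          congr 1
          refine lintegral_congr fun x => ?_
          rw [key, ENNReal.tsum_mul_left, ENNReal.tsum_mul_left]

lemma heatState_succ_eq (m k : ℕ) (x : ℝ) :
    heatState (m + 1) k x
      = ∫⁻ y : ℝ, ENNReal.ofReal (heatKernel (m + 1 : ℝ) (x - y)) *
          ENNReal.ofReal (evenState k y) := by
  induction m generalizing x with
  | zero => simp [heatState]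
  | succ m ih =>
    calc heatState (m + 2) k x
        = ∫⁻ z : ℝ, ENNReal.ofReal (heatKernel 1 (x - z)) * ∫⁻ y : ℝ,
            ENNReal.ofReal (heatKernel (m + 1 : ℝ) (z - y)) * ENNReal.ofReal (evenState k y) := by
          simp_rw [← ih]
          rfl
      _ = ∫⁻ z : ℝ, ∫⁻ y : ℝ, ENNReal.ofReal (heatKernel 1 (x - z)) *
            (ENNReal.ofReal (heatKernel (m + 1 : ℝ) (z - y)) * ENNReal.ofReal (evenState k y)) := by
          refine lintegral_congr fun z => ?_
          rw [lintegral_const_mul _ (by fun_prop)]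
      _ = ∫⁻ y : ℝ, ∫⁻ z : ℝ, ENNReal.ofReal (heatKernel 1 (x - z)) *
            (ENNReal.ofReal (heatKernel (m + 1 : ℝ) (z - y)) * ENNReal.ofReal (evenState k y)) :=
          lintegral_lintegral_swap (by
            unfold Function.uncurry
            fun_prop)
      _ = _ := by
          refine lintegral_congr fun y => ?_
          simp_rw [← mul_assoc]
          rw [lintegral_mul_const _ (by fun_prop),
            lintegral_heatKernel_mul_heatKernel (by positivity)]
          push_cast
          rfl

/-- The closed form of `∑ j, (ginibreKernelPow M j j) * t ^ (2 * j)`. -/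
noncomputable def traceGenFun (M : ℕ) (t : ℝ) : ℝ :=
  1 / √(M + 1 : ℝ) / 2 *
    (1 / √(1 - t) * (1 / √(1 + ((M : ℝ) - 1) / (M + 1) * t)) +
      1 / √(1 + t) * (1 / √(1 - ((M : ℝ) - 1) / (M + 1) * t)))

lemma tsum_ginibreKernelPow_one {t : ℝ} (ht : t ∈ Set.Ioo (0 : ℝ) 1) :
    ∑' j, ginibreKernelPow 1 j j * ENNReal.ofReal (t ^ (2 * j))
      = ENNReal.ofReal (traceGenFun 1 t) := by
  obtain ⟨ht0, ht1⟩ := ht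
  have hpi := Real.pi_pos
  have h1 : ∀ j, ginibreKernelPow 1 j j * ENNReal.ofReal (t ^ (2 * j))
      = ENNReal.ofReal (1 / √(2 * Real.pi)) *
        ∫⁻ x : ℝ, ENNReal.ofReal (evenState j x * evenState j x * t ^ (2 * j)) := by
    intro j
    rw [ginibreKernelPow_succ_eq, mul_assoc, ← lintegral_mul_const _ (by fun_prop)]
    congr 1
    refine lintegral_congr fun x => ?_
    rw [heatState, ← ENNReal.ofReal_mul (evenState_nonneg _ _),
      ← ENNReal.ofReal_mul (mul_nonneg (evenState_nonneg _ _) (evenState_nonneg _ _))]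
  have h2 : ∀ x : ℝ, ENNReal.ofReal (Real.exp (-(x ^ 2 + x ^ 2) / 2) * Real.cosh (t * (x * x)))
      = ENNReal.ofReal (1 / 2) * (ENNReal.ofReal (Real.exp (-(1 - t) * x ^ 2 + 0 * x)) +
        ENNReal.ofReal (Real.exp (-(1 + t) * x ^ 2 + 0 * x))) := by
    intro x
    rw [← ENNReal.ofReal_add (by positivity) (by positivity), ← ENNReal.ofReal_mul (by positivity),
      Real.cosh_eq,
      show -(1 - t) * x ^ 2 + 0 * x = -(x ^ 2 + x ^ 2) / 2 + t * (x * x) by ring,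
      show -(1 + t) * x ^ 2 + 0 * x = -(x ^ 2 + x ^ 2) / 2 + -(t * (x * x)) by ring,
      Real.exp_add, Real.exp_add]
    congr 1
    ring
  simp_rw [h1]
  rw [ENNReal.tsum_mul_left, ← lintegral_tsum (fun j => by fun_prop)]
  simp_rw [tsum_ofReal_evenState, h2]
  rw [lintegral_const_mul _ (by fun_prop), lintegral_add_left (by fun_prop),
    lintegral_exp_quadratic (by linarith), lintegral_exp_quadratic (by linarith),
    ← ENNReal.ofReal_add (by positivity) (by positivity), ← ENNReal.ofReal_mul (by positivity),
    ← ENNReal.ofReal_mul (by positivity)]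
  congr 1
  have e : √(2 * Real.pi) = √2 * √Real.pi := Real.sqrt_mul (by positivity) _
  have e2 : √(1 + 1 : ℝ) = √2 := by norm_num
  have hp : 0 < √Real.pi := Real.sqrt_pos.2 hpi
  rw [traceGenFun, Real.sqrt_div hpi.le, Real.sqrt_div hpi.le, e]
  simp [e2]
  field_simp

lemma tsum_ginibreKernelPow_add_two (m : ℕ) {t : ℝ} (ht : t ∈ Set.Ioo (0 : ℝ) 1) :
    ∑' j, ginibreKernelPow (m + 2) j j * ENNReal.ofReal (t ^ (2 * j))
      = ENNReal.ofReal (traceGenFun (m + 2) t) := by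
  obtain ⟨ht0, ht1⟩ := ht
  have hpi := Real.pi_pos
  set s : ℝ := m + 1 with hs
  have hs0 : 0 < s := by positivity
  have h1 : ∀ j, ginibreKernelPow (m + 2) j j * ENNReal.ofReal (t ^ (2 * j))
      = ENNReal.ofReal (1 / √(2 * Real.pi)) *
        ∫⁻ x : ℝ, ∫⁻ y : ℝ, ENNReal.ofReal (heatKernel s (x - y)) *
          ENNReal.ofReal (evenState j x * evenState j y * t ^ (2 * j)) := by
    intro j
    rw [ginibreKernelPow_succ_eq, mul_assoc, ← lintegral_mul_const _ (by fun_prop)]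
    congr 1
    refine lintegral_congr fun x => ?_
    rw [heatState_succ_eq, ← lintegral_const_mul _ (by fun_prop),
      ← lintegral_mul_const _ (by fun_prop)]
    refine lintegral_congr fun y => ?_
    rw [ENNReal.ofReal_mul (mul_nonneg (evenState_nonneg _ _) (evenState_nonneg _ _)),
      ENNReal.ofReal_mul (evenState_nonneg _ _)]
    ring
  have h2 : ∀ x y : ℝ, ENNReal.ofReal (heatKernel s (x - y)) *
        ENNReal.ofReal (Real.exp (-(x ^ 2 + y ^ 2) / 2) * Real.cosh (t * (x * y)))
      = ENNReal.ofReal (1 / √(2 * Real.pi * s) / 2) *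
        (ENNReal.ofReal (Real.exp (-((1 + 1 / s) / 2) * (x ^ 2 + y ^ 2) + (1 / s + t) * (x * y))) +
        ENNReal.ofReal (Real.exp (-((1 + 1 / s) / 2) * (x ^ 2 + y ^ 2) + (1 / s - t) * (x * y)))) := by
    intro x y
    have e0 : -(x - y) ^ 2 / (2 * s) = -(1 / s / 2) * (x ^ 2 + y ^ 2) + 1 / s * (x * y) := by
      field_simp
      ring
    rw [← ENNReal.ofReal_mul (heatKernel_nonneg _ _),
      ← ENNReal.ofReal_add (by positivity) (by positivity), ← ENNReal.ofReal_mul (by positivity),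
      Real.cosh_eq, heatKernel, e0,
      show -((1 + 1 / s) / 2) * (x ^ 2 + y ^ 2) + (1 / s + t) * (x * y) =
        -(1 / s / 2) * (x ^ 2 + y ^ 2) + 1 / s * (x * y) + -(x ^ 2 + y ^ 2) / 2 + t * (x * y) by ring,
      show -((1 + 1 / s) / 2) * (x ^ 2 + y ^ 2) + (1 / s - t) * (x * y) =
        -(1 / s / 2) * (x ^ 2 + y ^ 2) + 1 / s * (x * y) + -(x ^ 2 + y ^ 2) / 2 + -(t * (x * y))
        by ring, Real.exp_add _ (t * (x * y)), Real.exp_add _ (-(t * (x * y))),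
      Real.exp_add _ (-(x ^ 2 + y ^ 2) / 2)]
    congr 1
    ring
  have hB1 : |1 / s + t| < 1 + 1 / s := by
    rw [abs_of_pos (by positivity)]
    linarith
  have hB2 : |1 / s - t| < 1 + 1 / s := by
    have : 0 < 1 / s := by positivity
    rw [abs_lt]
    constructor <;> linarith
  have hm : ∀ B : ℝ, Measurable fun p : ℝ × ℝ => ENNReal.ofReal
      (Real.exp (-((1 + 1 / s) / 2) * (p.1 ^ 2 + p.2 ^ 2) + B * (p.1 * p.2))) := by
    intro B; fun_prop
  have hm' : ∀ j : ℕ, Measurable fun p : ℝ × ℝ => ENNReal.ofReal (heatKernel s (p.1 - p.2)) *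
          ENNReal.ofReal (evenState j p.1 * evenState j p.2 * t ^ (2 * j)) := by
    intro j; fun_prop
  simp_rw [h1]
  rw [ENNReal.tsum_mul_left, ← lintegral_tsum (fun j => (hm' j).lintegral_prod_right'.aemeasurable)]
  have h3 : ∀ x : ℝ, ∑' j, ∫⁻ y : ℝ, ENNReal.ofReal (heatKernel s (x - y)) *
          ENNReal.ofReal (evenState j x * evenState j y * t ^ (2 * j))
      = ENNReal.ofReal (1 / √(2 * Real.pi * s) / 2) *
        ((∫⁻ y : ℝ, ENNReal.ofReal
          (Real.exp (-((1 + 1 / s) / 2) * (x ^ 2 + y ^ 2) + (1 / s + t) * (x * y)))) +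
        ∫⁻ y : ℝ, ENNReal.ofReal
          (Real.exp (-((1 + 1 / s) / 2) * (x ^ 2 + y ^ 2) + (1 / s - t) * (x * y)))) := by
    intro x
    rw [← lintegral_tsum (fun j => by fun_prop), ← lintegral_add_left (by fun_prop),
      ← lintegral_const_mul _ (by fun_prop)]
    refine lintegral_congr fun y => ?_
    rw [ENNReal.tsum_mul_left, tsum_ofReal_evenState, h2]
  simp_rw [h3]
  have hmq : ∀ B : ℝ, Measurable fun x : ℝ => ∫⁻ y : ℝ, ENNReal.ofReal
      (Real.exp (-((1 + 1 / s) / 2) * (x ^ 2 + y ^ 2) + B * (x * y))) :=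
    fun B => (hm B).lintegral_prod_right'
  have hma : Measurable fun x : ℝ => (∫⁻ y : ℝ, ENNReal.ofReal
      (Real.exp (-((1 + 1 / s) / 2) * (x ^ 2 + y ^ 2) + (1 / s + t) * (x * y)))) +
      ∫⁻ y : ℝ, ENNReal.ofReal
        (Real.exp (-((1 + 1 / s) / 2) * (x ^ 2 + y ^ 2) + (1 / s - t) * (x * y))) :=
    (hmq _).add (hmq _)
  rw [lintegral_const_mul _ hma, lintegral_add_left (hmq _),
    lintegral_lintegral_exp_quadratic hB1, lintegral_lintegral_exp_quadratic hB2,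
    ← ENNReal.ofReal_add (by positivity) (by positivity), ← ENNReal.ofReal_mul (by positivity),
    ← ENNReal.ofReal_mul (by positivity)]
  congr 1
  have hc : ((m + 2 : ℕ) : ℝ) = s + 1 := by rw [hs]; push_cast; ring
  have hct : s / (s + 2) * t < 1 := by
    rw [div_mul_eq_mul_div, div_lt_one (by positivity)]
    nlinarith
  have e1 : (1 + 1 / s) ^ 2 - (1 / s + t) ^ 2
      = (s + 2) * ((1 - t) * (1 + s / (s + 2) * t)) / s := by
    field_simp
    ring
  have e2 : (1 + 1 / s) ^ 2 - (1 / s - t) ^ 2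
      = (s + 2) * ((1 + t) * (1 - s / (s + 2) * t)) / s := by
    field_simp
    ring
  have p1 : 0 < √(1 - t) := Real.sqrt_pos.2 (by linarith)
  have p2 : 0 < √(1 - s / (s + 2) * t) := Real.sqrt_pos.2 (by linarith)
  have p3 : 0 < √(1 + s / (s + 2) * t) := Real.sqrt_pos.2 (by positivity)
  have q1 : 0 ≤ 1 - t := by linarith
  have q2 : 0 ≤ 1 - s / (s + 2) * t := by linarith
  have q3 : 0 ≤ 1 + s / (s + 2) * t := by positivity
  rw [traceGenFun, hc, e1, e2, show s + 1 - 1 = s by ring, show s + 1 + 1 = s + 2 by ring,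
    Real.sqrt_div (by positivity), Real.sqrt_div (by positivity),
    Real.sqrt_mul (by positivity : 0 ≤ s + 2), Real.sqrt_mul q1,
    Real.sqrt_mul (by positivity : 0 ≤ s + 2), Real.sqrt_mul (by positivity : 0 ≤ 1 + t),
    Real.sqrt_mul (by positivity : 0 ≤ 2 * Real.pi)]
  have p4 : 0 < √(2 * Real.pi) := Real.sqrt_pos.2 (by positivity)
  have e3 : √(2 * Real.pi) ^ 2 = 2 * Real.pi := Real.sq_sqrt (by positivity)
  have p5 : 0 < √s := Real.sqrt_pos.2 hs0
  generalize √(2 * Real.pi) = r at p4 e3 ⊢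
  rw [← e3]
  field_simp

lemma tsum_ginibreKernelPow {M : ℕ} (hM : 1 ≤ M) {t : ℝ} (ht : t ∈ Set.Ioo (0 : ℝ) 1) :
    ∑' j, ginibreKernelPow M j j * ENNReal.ofReal (t ^ (2 * j))
      = ENNReal.ofReal (traceGenFun M t) := by
  match M, hM with
  | 1, _ => exact tsum_ginibreKernelPow_one ht
  | m + 2, _ => exact tsum_ginibreKernelPow_add_two m ht

lemma ginibreKernelPow_diag_ne_top {M : ℕ} (hM : 1 ≤ M) (j : ℕ) : ginibreKernelPow M j j ≠ ⊤ := by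
  have ht : (1 / 2 : ℝ) ∈ Set.Ioo (0 : ℝ) 1 := by norm_num
  have h : ginibreKernelPow M j j * ENNReal.ofReal ((1 / 2) ^ (2 * j)) ≠ ⊤ := by
    refine ne_top_of_le_ne_top ?_ (ENNReal.le_tsum (f := fun j => ginibreKernelPow M j j *
      ENNReal.ofReal ((1 / 2) ^ (2 * j))) j)
    rw [tsum_ginibreKernelPow hM ht]
    exact ENNReal.ofReal_ne_top
  intro h'
  rw [h', ENNReal.top_mul (by simp)] at h
  exact h rfl

/-- The truncated trace of a power of the infinite matrix. -/
noncomputable def truncTrace (M n : ℕ) : ℝ :=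
  ∑ j ∈ Finset.range n, (ginibreKernelPow M j j).toReal

lemma traceGenFun_nonneg (M : ℕ) (t : ℝ) : 0 ≤ traceGenFun M t := by
  unfold traceGenFun
  positivity

lemma hasSum_ginibreKernelPow {M : ℕ} (hM : 1 ≤ M) {t : ℝ} (ht : t ∈ Set.Ioo (0 : ℝ) 1) :
    HasSum (fun j => (ginibreKernelPow M j j).toReal * t ^ (2 * j)) (traceGenFun M t) := by
  have h := tsum_ginibreKernelPow hM ht
  have hs := ENNReal.hasSum_toReal (f := fun j => ginibreKernelPow M j j *
    ENNReal.ofReal (t ^ (2 * j))) (by rw [h]; exact ENNReal.ofReal_ne_top)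
  rw [← ENNReal.tsum_toReal_eq (fun j => ENNReal.mul_ne_top (ginibreKernelPow_diag_ne_top hM j)
    ENNReal.ofReal_ne_top), h, ENNReal.toReal_ofReal (traceGenFun_nonneg M t)] at hs
  refine hs.congr_fun fun j => ?_
  rw [ENNReal.toReal_mul, ENNReal.toReal_ofReal (pow_nonneg ht.1.le _)]

lemma tendsto_truncTrace {M : ℕ} (hM : 1 ≤ M) :
    Tendsto (fun n : ℕ => truncTrace M n / √n) atTop (𝓝 (1 / √(Real.pi * M))) := by
  have hM' : (1 : ℝ) ≤ M := by exact_mod_cast hM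
  have h := tendsto_sum_div_sqrt_of_hasSum (c := ((M : ℝ) - 1) / (M + 1)) (κ := 1 / √(M + 1 : ℝ))
    (div_nonneg (by linarith) (by linarith)) ((div_lt_one (by positivity)).2 (by linarith))
    (fun t ht => hasSum_ginibreKernelPow hM ht)
  refine h.congr' (Eventually.of_forall fun n => rfl) |>.trans (le_of_eq ?_)
  congr 1
  have e : 1 + ((M : ℝ) - 1) / (M + 1) = 2 * M / (M + 1) := by
    field_simp
    ring
  have e2 : √(2 : ℝ) ^ 2 = 2 := Real.sq_sqrt (by norm_num)
  have p : 0 < √(M : ℝ) := Real.sqrt_pos.2 (by linarith)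
  have p' : 0 < √Real.pi := Real.sqrt_pos.2 Real.pi_pos
  rw [e, Real.sqrt_div (by positivity), Real.sqrt_mul (by positivity), Real.sqrt_mul Real.pi_pos.le]
  field_simp
  linarith

lemma truncTrace_le {M n : ℕ} (hM : 1 ≤ M) (hn : 1 ≤ n) :
    truncTrace M n ≤ Real.exp 2 * √(n + 1) / √(M + 1) := by
  have hM' : (1 : ℝ) ≤ M := by exact_mod_cast hM
  have hn' : (1 : ℝ) ≤ n := by exact_mod_cast hn
  set t : ℝ := n / (n + 1) with htdef
  have ht : t ∈ Set.Ioo (0 : ℝ) 1 := ⟨by positivity, (div_lt_one (by positivity)).2 (by linarith)⟩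
  have ht0 := ht.1
  have ht1 := ht.2
  have h1 : t ^ (2 * n) * truncTrace M n ≤ traceGenFun M t := by
    rw [truncTrace, Finset.mul_sum]
    refine le_trans (Finset.sum_le_sum fun j hj => ?_)
      (sum_le_hasSum (Finset.range n) (fun j _ => by positivity) (hasSum_ginibreKernelPow hM ht))
    rw [mul_comm]
    gcongr ?_ * ?_
    refine pow_le_pow_of_le_one ht0.le ht1.le ?_
    have := Finset.mem_range.1 hj
    omega
  set c : ℝ := ((M : ℝ) - 1) / (M + 1) with hc
  have hc0 : 0 ≤ c := div_nonneg (by linarith) (by linarith)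
  have hc1 : c < 1 := (div_lt_one (by positivity)).2 (by linarith)
  have hct : c * t ≤ t := by nlinarith
  have p1 : 0 < √(1 - t) := Real.sqrt_pos.2 (by linarith)
  have h2 : traceGenFun M t ≤ 1 / √(M + 1 : ℝ) * (1 / √(1 - t)) := by
    have a1 : 1 / √(1 - t) * (1 / √(1 + c * t)) ≤ 1 / √(1 - t) := by
      refine mul_le_of_le_one_right (by positivity) ?_
      rw [div_le_one (by positivity)]
      exact Real.one_le_sqrt.2 (by nlinarith)
    have a2 : 1 / √(1 + t) * (1 / √(1 - c * t)) ≤ 1 / √(1 - t) := by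
      have b1 : 1 / √(1 + t) ≤ 1 := by
        rw [div_le_one (by positivity)]
        exact Real.one_le_sqrt.2 (by linarith)
      have b2 : 1 / √(1 - c * t) ≤ 1 / √(1 - t) := by gcongr
      calc _ ≤ 1 * (1 / √(1 - t)) := by gcongr
        _ = _ := one_mul _
    rw [traceGenFun, ← hc]
    calc _ ≤ 1 / √(M + 1 : ℝ) / 2 * (1 / √(1 - t) + 1 / √(1 - t)) := by gcongr
      _ = _ := by ring
  have e1 : 1 - t = 1 / (n + 1) := by rw [htdef]; field_simp; ring
  have e2 : 1 / √(1 - t) = √(n + 1) := by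
    rw [e1, Real.sqrt_div zero_le_one, Real.sqrt_one, one_div_one_div]
  have e3 : Real.exp (-2) ≤ t ^ (2 * n) := by
    have : Real.exp (-(1 / n)) ≤ t := by
      rw [Real.exp_neg, inv_le_comm₀ (Real.exp_pos _) ht0]
      have := Real.add_one_le_exp (1 / n : ℝ)
      refine le_trans (le_of_eq ?_) this
      rw [htdef]
      field_simp
      ring
    calc Real.exp (-2) = Real.exp (-(1 / n)) ^ (2 * n) := by
          rw [← Real.exp_nat_mul]
          congr 1
          push_cast
          field_simp
      _ ≤ _ := by gcongr
  have hT : 0 ≤ truncTrace M n := Finset.sum_nonneg fun _ _ => ENNReal.toReal_nonneg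
  rw [e2] at h2
  have h3 : Real.exp (-2) * truncTrace M n ≤ 1 / √(M + 1 : ℝ) * √(n + 1) :=
    (mul_le_mul_of_nonneg_right e3 hT).trans (h1.trans h2)
  rw [Real.exp_neg, inv_mul_le_iff₀ (Real.exp_pos _)] at h3
  calc _ ≤ _ := h3
    _ = _ := by ring

lemma ginibreKernel_comm (j k : ℕ) : ginibreKernel j k = ginibreKernel k j := by
  rw [ginibreKernel, ginibreEntry_comm, ginibreKernel]

lemma ginibreKernelPow_one (j k : ℕ) : ginibreKernelPow 1 j k = ginibreKernel j k := by
  simp only [ginibreKernelPow, mul_ite, mul_one, mul_zero, tsum_ite_eq]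

lemma tsum_ginibreKernelPow_mul (a b j k : ℕ) :
    ∑' l, ginibreKernelPow a j l * ginibreKernelPow b l k = ginibreKernelPow (a + b) j k := by
  induction a generalizing j with
  | zero =>
    simp only [ginibreKernelPow, ite_mul, one_mul, zero_mul, zero_add, tsum_ite_eq']
  | succ a ih =>
    have h : ∀ c j k, ginibreKernelPow (c + 1) j k
        = ∑' l, ginibreKernel j l * ginibreKernelPow c l k := fun _ _ _ => rfl
    rw [show a + 1 + b = a + b + 1 by omega]
    simp_rw [h, ← ih, ← ENNReal.tsum_mul_left, ← ENNReal.tsum_mul_right]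
    rw [ENNReal.tsum_comm]
    simp_rw [mul_assoc]

lemma ginibreKernelPow_comm (m j k : ℕ) : ginibreKernelPow m j k = ginibreKernelPow m k j := by
  induction m generalizing j k with
  | zero => simp only [ginibreKernelPow, eq_comm]
  | succ m ih =>
    rw [← tsum_ginibreKernelPow_mul, ginibreKernelPow]
    refine tsum_congr fun l => ?_
    rw [ih j l, ginibreKernelPow_one, ginibreKernel_comm, mul_comm]

/-- The powers of the leading `n × n` block of `ginibreKernel`. -/
noncomputable def truncKernelPow (n : ℕ) : ℕ → ℕ → ℕ → ENNReal
  | 0, j, k => if j = k then 1 else 0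
  | i + 1, j, k => ∑ l ∈ Finset.range n, truncKernelPow n i j l * ginibreKernel l k

lemma truncKernelPow_le (n i j k : ℕ) : truncKernelPow n i j k ≤ ginibreKernelPow i j k := by
  induction i generalizing k with
  | zero => rw [truncKernelPow, ginibreKernelPow]
  | succ i ih =>
    rw [truncKernelPow, ← tsum_ginibreKernelPow_mul]
    refine le_trans (Finset.sum_le_sum fun l _ => ?_) (ENNReal.sum_le_tsum (Finset.range n))
    rw [ginibreKernelPow_one]
    gcongr
    exact ih l

lemma ENNReal.sum_range_add_tsum_nat_add (f : ℕ → ENNReal) (n : ℕ) :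
    ∑ i ∈ Finset.range n, f i + ∑' i, f (i + n) = ∑' i, f i :=
  ENNReal.summable.sum_add_tsum_nat_add' 

lemma ENNReal.tsum_nat_add_le (f : ℕ → ENNReal) (n : ℕ) : ∑' i, f (i + n) ≤ ∑' i, f i := by
  rw [← ENNReal.sum_range_add_tsum_nat_add f n]
  exact le_add_self

lemma ENNReal.mul_le_inv_mul_sq_add_mul_sq (a b : ENNReal) {ε : ENNReal} (h0 : ε ≠ 0)
    (h1 : ε ≠ ⊤) : a * b ≤ ε⁻¹ * a ^ 2 + ε * b ^ 2 := by
  rcases le_total a (ε * b) with h | h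
  · calc a * b ≤ ε * b * b := by gcongr
      _ = ε * b ^ 2 := by ring
      _ ≤ _ := le_add_self
  · have h' : b ≤ ε⁻¹ * a := by
      calc b = ε⁻¹ * (ε * b) := by rw [← mul_assoc, ENNReal.inv_mul_cancel h0 h1, one_mul]
        _ ≤ _ := by gcongr
    calc a * b ≤ a * (ε⁻¹ * a) := by gcongr
      _ = ε⁻¹ * a ^ 2 := by ring
      _ ≤ _ := le_self_add

/-- The weight of the closed paths of length `m + 1` whose first step leaves `{0, …, n - 1}`. -/
noncomputable def leakage (n m : ℕ) : ENNReal :=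
  ∑ l ∈ Finset.range n, ∑' r, ginibreKernel l (r + n) * ginibreKernelPow m (r + n) l

/-- The trace of a product of powers of the truncated and of the infinite matrix. -/
noncomputable def mixedTrace (n i k : ℕ) : ENNReal :=
  ∑ j ∈ Finset.range n, ∑ l ∈ Finset.range n, truncKernelPow n i j l * ginibreKernelPow k l j

lemma mixedTrace_succ_le (n i k : ℕ) :
    mixedTrace n i (k + 1) ≤ mixedTrace n (i + 1) k + leakage n (i + k) := by
  have h1 : ∀ j l : ℕ, truncKernelPow n i j l * ginibreKernelPow (k + 1) l j
      = ∑ r ∈ Finset.range n, truncKernelPow n i j l * ginibreKernel l r * ginibreKernelPow k r j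
        + ∑' r, truncKernelPow n i j l * ginibreKernel l (r + n) *
            ginibreKernelPow k (r + n) j := by
    intro j l
    rw [ENNReal.sum_range_add_tsum_nat_add
      (fun r => truncKernelPow n i j l * ginibreKernel l r * ginibreKernelPow k r j),
      ginibreKernelPow, ← ENNReal.tsum_mul_left]
    simp_rw [mul_assoc]
  simp_rw [mixedTrace, h1, Finset.sum_add_distrib]
  refine add_le_add (le_of_eq ?_) ?_
  · refine Finset.sum_congr rfl fun j _ => ?_
    rw [Finset.sum_comm]
    refine Finset.sum_congr rfl fun r _ => ?_
    rw [truncKernelPow, Finset.sum_mul]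
  · rw [Finset.sum_comm, leakage]
    refine Finset.sum_le_sum fun l _ => ?_
    rw [← Summable.tsum_finsetSum (fun _ _ => ENNReal.summable)]
    refine ENNReal.tsum_le_tsum fun r => ?_
    rw [add_comm i k, ← tsum_ginibreKernelPow_mul, ← ENNReal.tsum_mul_left]
    refine le_trans (Finset.sum_le_sum fun j _ => ?_) (ENNReal.sum_le_tsum (Finset.range n))
    rw [mul_comm (truncKernelPow n i j l), mul_assoc, mul_comm (truncKernelPow n i j l)]
    gcongr
    exact truncKernelPow_le n i j l

lemma mixedTrace_zero_le (n m i : ℕ) :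
    mixedTrace n 0 (m + i) ≤ mixedTrace n i m + i * leakage n (m + i - 1) := by
  induction i generalizing m with
  | zero => simp
  | succ i ih =>
    have h := mixedTrace_succ_le n i m
    have h2 := ih (m + 1)
    rw [show m + 1 + i - 1 = i + m by omega] at h2
    rw [show m + (i + 1) = m + 1 + i by omega, show m + 1 + i - 1 = i + m by omega]
    calc _ ≤ _ := h2
      _ ≤ mixedTrace n (i + 1) m + leakage n (i + m) + i * leakage n (i + m) := by gcongr
      _ = _ := by push_cast; ring

lemma mixedTrace_zero_left (n m : ℕ) :
    mixedTrace n 0 m = ∑ j ∈ Finset.range n, ginibreKernelPow m j j := by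
  refine Finset.sum_congr rfl fun j hj => ?_
  simp only [truncKernelPow, ite_mul, one_mul, zero_mul, Finset.sum_ite_eq, if_pos hj]

lemma mixedTrace_zero_right (n i : ℕ) :
    mixedTrace n i 0 = ∑ j ∈ Finset.range n, truncKernelPow n i j j := by
  refine Finset.sum_congr rfl fun j hj => ?_
  simp only [ginibreKernelPow, mul_ite, mul_one, mul_zero, Finset.sum_ite_eq', if_pos hj]

/-- The squared Hilbert–Schmidt norm of the off-diagonal block. -/
noncomputable def leakSq (n : ℕ) : ENNReal :=
  ∑ l ∈ Finset.range n, ∑' r, ginibreKernel l (r + n) ^ 2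

lemma sum_truncKernelPow_two_add_leakSq (n : ℕ) :
    ∑ j ∈ Finset.range n, truncKernelPow n 2 j j + leakSq n
      = ∑ j ∈ Finset.range n, ginibreKernelPow 2 j j := by
  rw [leakSq, ← Finset.sum_add_distrib]
  refine Finset.sum_congr rfl fun j hj => ?_
  have h1 : ginibreKernelPow 2 j j = ∑' r, ginibreKernel j r ^ 2 := by
    rw [ginibreKernelPow]
    refine tsum_congr fun l => ?_
    rw [ginibreKernelPow_one, ginibreKernel_comm l j, sq]
  have h2 : truncKernelPow n 2 j j = ∑ r ∈ Finset.range n, ginibreKernel j r ^ 2 := by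
    rw [truncKernelPow]
    refine Finset.sum_congr rfl fun l _ => ?_
    simp only [truncKernelPow, ite_mul, one_mul, zero_mul, Finset.sum_ite_eq, if_pos hj]
    rw [ginibreKernel_comm l j, sq]
  rw [h1, h2, ENNReal.sum_range_add_tsum_nat_add (fun r => ginibreKernel j r ^ 2)]

lemma leakage_le (n m : ℕ) {ε : ENNReal} (h0 : ε ≠ 0) (h1 : ε ≠ ⊤) :
    leakage n m ≤ ε⁻¹ * leakSq n + ε * ∑ j ∈ Finset.range n, ginibreKernelPow (m + m) j j := by
  rw [leakage, leakSq, Finset.mul_sum, Finset.mul_sum, ← Finset.sum_add_distrib]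
  refine Finset.sum_le_sum fun l _ => ?_
  calc _ ≤ ∑' r, (ε⁻¹ * ginibreKernel l (r + n) ^ 2 + ε * ginibreKernelPow m (r + n) l ^ 2) :=
        ENNReal.tsum_le_tsum fun r => ENNReal.mul_le_inv_mul_sq_add_mul_sq _ _ h0 h1
    _ = ε⁻¹ * ∑' r, ginibreKernel l (r + n) ^ 2 + ε * ∑' r, ginibreKernelPow m (r + n) l ^ 2 := by
        rw [ENNReal.tsum_add, ENNReal.tsum_mul_left, ENNReal.tsum_mul_left]
    _ ≤ _ := by
        gcongr
        refine (ENNReal.tsum_nat_add_le (fun r => ginibreKernelPow m r l ^ 2) n).trans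
          (le_of_eq ?_)
        rw [← tsum_ginibreKernelPow_mul]
        refine tsum_congr fun r => ?_
        rw [ginibreKernelPow_comm m l r, sq]

/-- The trace of a power of the leading `n × n` block. -/
noncomputable def blockTrace (m n : ℕ) : ℝ :=
  (∑ j ∈ Finset.range n, truncKernelPow n m j j).toReal

lemma sum_ginibreKernelPow_ne_top {m : ℕ} (hm : 1 ≤ m) (n : ℕ) :
    ∑ j ∈ Finset.range n, ginibreKernelPow m j j ≠ ⊤ :=
  ENNReal.sum_ne_top.2 fun j _ => ginibreKernelPow_diag_ne_top hm j

lemma truncTrace_eq_toReal {m : ℕ} (hm : 1 ≤ m) (n : ℕ) :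
    truncTrace m n = (∑ j ∈ Finset.range n, ginibreKernelPow m j j).toReal := by
  rw [truncTrace, ENNReal.toReal_sum fun j _ => ginibreKernelPow_diag_ne_top hm j]

lemma sum_truncKernelPow_le (m n : ℕ) : ∑ j ∈ Finset.range n, truncKernelPow n m j j
      ≤ ∑ j ∈ Finset.range n, ginibreKernelPow m j j :=
  Finset.sum_le_sum fun j _ => truncKernelPow_le n m j j

lemma blockTrace_le {m : ℕ} (hm : 1 ≤ m) (n : ℕ) : blockTrace m n ≤ truncTrace m n := by
  rw [truncTrace_eq_toReal hm, blockTrace]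
  exact ENNReal.toReal_mono (sum_ginibreKernelPow_ne_top hm n) (sum_truncKernelPow_le m n)

lemma truncTrace_le_blockTrace_add {m : ℕ} (hm : 2 ≤ m) (n : ℕ) {ε : ℝ} (hε : 0 < ε) :
    truncTrace m n ≤ blockTrace m n + m * (ε⁻¹ * (truncTrace 2 n - blockTrace 2 n)
      + ε * truncTrace ((m - 1) + (m - 1)) n) := by
  have h := mixedTrace_zero_le n 0 m
  have hl := leakage_le n (m - 1) (ε := ENNReal.ofReal ε) (by simpa using hε) ENNReal.ofReal_ne_top
  rw [zero_add, mixedTrace_zero_left, mixedTrace_zero_right] at h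
  have h2 := sum_truncKernelPow_two_add_leakSq n
  have f2 := sum_ginibreKernelPow_ne_top (m := 2) (by norm_num) n
  have fm := sum_ginibreKernelPow_ne_top (m := m) (by omega) n
  have fm' := sum_ginibreKernelPow_ne_top (m := (m - 1) + (m - 1)) (by omega) n
  have fb2 : ∑ j ∈ Finset.range n, truncKernelPow n 2 j j ≠ ⊤ :=
    ne_top_of_le_ne_top f2 (sum_truncKernelPow_le 2 n)
  have fbm : ∑ j ∈ Finset.range n, truncKernelPow n m j j ≠ ⊤ :=
    ne_top_of_le_ne_top fm (sum_truncKernelPow_le m n)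
  have fl : leakSq n ≠ ⊤ := ne_top_of_le_ne_top f2 (h2 ▸ le_add_self)
  have hS : (leakSq n).toReal = truncTrace 2 n - blockTrace 2 n := by
    rw [truncTrace_eq_toReal (by norm_num), ← h2, ENNReal.toReal_add fb2 fl, blockTrace]
    ring
  have hi : (ENNReal.ofReal ε)⁻¹ ≠ ⊤ := by simpa using hε
  have hfin : (ENNReal.ofReal ε)⁻¹ * leakSq n + ENNReal.ofReal ε *
      ∑ j ∈ Finset.range n, ginibreKernelPow ((m - 1) + (m - 1)) j j ≠ ⊤ :=
    ENNReal.add_ne_top.2 ⟨ENNReal.mul_ne_top hi fl, ENNReal.mul_ne_top ENNReal.ofReal_ne_top fm'⟩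
  have h3 := ENNReal.toReal_mono (ENNReal.add_ne_top.2 ⟨fbm, ENNReal.mul_ne_top
    (ENNReal.natCast_ne_top m) hfin⟩) (h.trans (add_le_add_right (mul_le_mul_right hl _) _))
  rw [← truncTrace_eq_toReal (by omega), ENNReal.toReal_add fbm (ENNReal.mul_ne_top
    (ENNReal.natCast_ne_top m) hfin), ENNReal.toReal_mul, ENNReal.toReal_add
    (ENNReal.mul_ne_top hi fl) (ENNReal.mul_ne_top ENNReal.ofReal_ne_top fm'), ENNReal.toReal_mul,
    ENNReal.toReal_mul, ENNReal.toReal_inv, ENNReal.toReal_ofReal hε.le, hS,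
    ← truncTrace_eq_toReal (by omega), ENNReal.toReal_natCast] at h3
  exact h3

lemma blockTrace_one (n : ℕ) : blockTrace 1 n = truncTrace 1 n := by
  rw [truncTrace_eq_toReal le_rfl, blockTrace]
  congr 1
  refine Finset.sum_congr rfl fun j hj => ?_
  simp only [truncKernelPow, ite_mul, one_mul, zero_mul, Finset.sum_ite_eq, if_pos hj]
  rw [ginibreKernelPow_one]

lemma Gamma_nat_add_half_eq_factorial (s : ℕ) : Real.Gamma ((s : ℕ) + 1 / 2)
    = ((2 * s).factorial : ℝ) / (4 ^ s * s.factorial) * √Real.pi := by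
  induction s with
  | zero => simpa using Real.Gamma_one_half_eq
  | succ s ih =>
    rw [show ((s + 1 : ℕ) : ℝ) + 1 / 2 = (s : ℝ) + 1 / 2 + 1 by push_cast; ring,
      Real.Gamma_add_one (by positivity), ih, mul_add_one, Nat.factorial_succ, Nat.factorial_succ,
      Nat.factorial_succ]
    push_cast
    field_simp
    ring

lemma ginibreEntry_sq (j k : ℕ) : ginibreEntry j k ^ 2
    = 1 / 2 * (centralCoeff (j + k) * ((2 * (j + k)).choose (2 * j) / 4 ^ (j + k))) := by
  have hpi := Real.pi_pos
  have hG : Real.Gamma ((j + k : ℕ) + 1 / 2)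
      = ((2 * (j + k)).factorial : ℝ) / (4 ^ (j + k) * (j + k).factorial) * √Real.pi :=
    Gamma_nat_add_half_eq_factorial _
  have hc : ((2 * (j + k)).choose (2 * j) : ℝ)
      = (2 * (j + k)).factorial / ((2 * j).factorial * (2 * k).factorial) := by
    rw [Nat.cast_choose ℝ (by omega), show 2 * (j + k) - 2 * j = 2 * k by omega]
  have hcc : centralCoeff (j + k)
      = (2 * (j + k)).factorial / ((j + k).factorial * (j + k).factorial) / 4 ^ (j + k) := by
    rw [centralCoeff, Nat.centralBinom, Nat.cast_choose ℝ (by omega),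
      show 2 * (j + k) - (j + k) = j + k by omega]
  rw [ginibreEntry_eq, hG, hc, hcc]
  simp only [mul_pow, div_pow]
  rw [Real.sq_sqrt (by positivity), Real.sq_sqrt (by positivity), Real.sq_sqrt (by positivity),
    Real.sq_sqrt (by positivity)]
  field_simp

lemma sum_range_choose_mul_sub_sq (s : ℕ) :
    ∑ p ∈ Finset.range (2 * s + 1), ((2 * s).choose p : ℝ) * ((p : ℝ) - s) ^ 2
      = 4 ^ s * (s / 2) := by
  have h := congrArg (Polynomial.eval (1 / 2 : ℝ)) (bernsteinPolynomial.variance ℝ (2 * s))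
  simp only [Polynomial.eval_finsetSum, bernsteinPolynomial, Polynomial.eval_mul,
    Polynomial.eval_pow, Polynomial.eval_sub, Polynomial.eval_X,
    Polynomial.eval_natCast, Polynomial.eval_one, nsmul_eq_mul] at h
  have h2 : ∀ p ∈ Finset.range (2 * s + 1), ((2 * s).choose p : ℝ) * ((p : ℝ) - s) ^ 2
      = 4 ^ s * ((((2 * s : ℕ) : ℝ) * (1 / 2) - p) ^ 2 *
        ((2 * s).choose p * (1 / 2) ^ p * (1 - 1 / 2) ^ (2 * s - p))) := by
    intro p hp
    have hp' := Finset.mem_range.1 hp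
    have e : (1 / 2 : ℝ) ^ p * (1 - 1 / 2) ^ (2 * s - p) = (1 / 4) ^ s := by
      rw [show (1 - 1 / 2 : ℝ) = 1 / 2 by norm_num, ← pow_add,
        show p + (2 * s - p) = 2 * s by omega, pow_mul]
      norm_num
    rw [mul_assoc ((2 * s).choose p : ℝ), e]
    push_cast
    rw [one_div_pow]
    field_simp
    ring
  rw [Finset.sum_congr rfl h2, ← Finset.mul_sum, h]
  push_cast
  ring

lemma sum_range_two_mul_add_one (f : ℕ → ℝ) (s : ℕ) :
    ∑ p ∈ Finset.range (2 * s + 1), f p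
      = ∑ j ∈ Finset.range (s + 1), f (2 * j) + ∑ j ∈ Finset.range s, f (2 * j + 1) := by
  induction s with
  | zero => simp
  | succ s ih =>
    rw [show 2 * (s + 1) + 1 = 2 * s + 1 + 1 + 1 by ring, Finset.sum_range_succ,
      Finset.sum_range_succ, ih, Finset.sum_range_succ _ (s + 1), Finset.sum_range_succ _ s,
      Finset.sum_range_succ _ s, mul_add_one]
    ring

lemma half_le_sum_choose_two_mul (s : ℕ) :
    4 ^ s / 2 ≤ ∑ j ∈ Finset.range (s + 1), ((2 * s).choose (2 * j) : ℝ) := by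
  rcases Nat.eq_zero_or_pos s with rfl | hs
  · norm_num
  have h1 : ∑ p ∈ Finset.range (2 * s + 1), ((2 * s).choose p : ℝ) = 4 ^ s := by
    have := Nat.sum_range_choose (2 * s)
    rw [pow_mul] at this
    exact_mod_cast this
  have h2 : ∑ p ∈ Finset.range (2 * s + 1), (-1 : ℝ) ^ p * ((2 * s).choose p : ℝ) = 0 := by
    have := Int.alternating_sum_range_choose_of_ne (n := 2 * s) (by omega)
    exact_mod_cast this
  rw [sum_range_two_mul_add_one] at h1 h2
  simp only [(even_two_mul _).neg_one_pow, (odd_two_mul_add_one _).neg_one_pow, one_mul, neg_mul,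
    Finset.sum_neg_distrib] at h2
  linarith

lemma sum_choose_two_mul_mul_sub_sq_le (s : ℕ) :
    ∑ j ∈ Finset.range (s + 1), ((2 * s).choose (2 * j) : ℝ) * ((2 * j : ℝ) - s) ^ 2
      ≤ 4 ^ s * (s / 2) := by
  have h := sum_range_choose_mul_sub_sq s
  rw [sum_range_two_mul_add_one] at h
  rw [← h]
  push_cast
  refine le_add_of_nonneg_right (Finset.sum_nonneg fun j _ => by positivity)

lemma sum_filter_choose_ge {n s d : ℕ} (hd : 0 < d) (hs : s + d ≤ 2 * n) :
    1 / 2 - n / (d : ℝ) ^ 2 ≤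
      ∑ p ∈ (Finset.HasAntidiagonal.antidiagonal s).filter (fun p => p.1 < n ∧ p.2 < n),
      ((2 * s).choose (2 * p.1) : ℝ) / 4 ^ s := by
  rw [Finset.sum_filter, Finset.Nat.sum_antidiagonal_eq_sum_range_succ_mk]
  have hd' : (0 : ℝ) < d := by exact_mod_cast hd
  have h1 : ∀ j ∈ Finset.range (s + 1), (((2 * s).choose (2 * j) : ℝ)
      - ((2 * s).choose (2 * j) : ℝ) * ((2 * j : ℝ) - s) ^ 2 / d ^ 2) / 4 ^ s
      ≤ if j < n ∧ s - j < n then ((2 * s).choose (2 * j) : ℝ) / 4 ^ s else 0 := by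
    intro j hj
    have hj' := Finset.mem_range.1 hj
    split_ifs with hif
    · gcongr
      exact sub_le_self _ (by positivity)
    · refine div_nonpos_of_nonpos_of_nonneg ?_ (by positivity)
      have h2 : (d : ℝ) ^ 2 ≤ ((2 * j : ℝ) - s) ^ 2 := by
        have hsd : (s + d : ℝ) ≤ 2 * n := by exact_mod_cast hs
        rw [not_and_or, not_lt, not_lt] at hif
        rcases hif with h | h
        · have : (n : ℝ) ≤ j := by exact_mod_cast h
          nlinarith
        · have : (n + j : ℝ) ≤ s := by
            have : n + j ≤ s := by omega
            exact_mod_cast this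
          nlinarith
      rw [sub_nonpos, mul_div_assoc]
      refine le_mul_of_one_le_right (by positivity) ?_
      rwa [one_le_div (by positivity)]
  refine le_trans ?_ (Finset.sum_le_sum h1)
  rw [← Finset.sum_div, Finset.sum_sub_distrib, ← Finset.sum_div]
  have a := half_le_sum_choose_two_mul s
  have b := sum_choose_two_mul_mul_sub_sq_le s
  have hsn : (s : ℝ) / 2 ≤ n := by
    have : (s : ℝ) ≤ 2 * n := by exact_mod_cast (by omega : s ≤ 2 * n)
    linarith
  rw [le_div_iff₀ (by positivity)]
  calc (1 / 2 - n / (d : ℝ) ^ 2) * 4 ^ s ≤ (1 / 2 - (s / 2) / (d : ℝ) ^ 2) * 4 ^ s := by gcongr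
    _ = 4 ^ s / 2 - 4 ^ s * (s / 2) / (d : ℝ) ^ 2 := by ring
    _ ≤ _ := by gcongr

lemma blockTrace_two (n : ℕ) : blockTrace 2 n
    = ∑ p ∈ Finset.range n ×ˢ Finset.range n, ginibreEntry p.1 p.2 ^ 2 := by
  have h : ∑ j ∈ Finset.range n, truncKernelPow n 2 j j
      = ∑ j ∈ Finset.range n, ∑ k ∈ Finset.range n, ENNReal.ofReal (ginibreEntry j k ^ 2) := by
    refine Finset.sum_congr rfl fun j hj => ?_
    rw [truncKernelPow]
    refine Finset.sum_congr rfl fun l _ => ?_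
    simp only [truncKernelPow, ite_mul, one_mul, zero_mul, Finset.sum_ite_eq, if_pos hj]
    rw [ginibreKernel_comm l j, ← sq, ginibreKernel, ENNReal.ofReal_pow (ginibreEntry_nonneg _ _)]
  rw [blockTrace, h, ← Finset.sum_product', ← ENNReal.ofReal_sum_of_nonneg
    (fun _ _ => sq_nonneg _), ENNReal.toReal_ofReal (Finset.sum_nonneg fun _ _ => sq_nonneg _)]

lemma blockTrace_two_ge {n d : ℕ} (hd : 0 < d) :
    1 / 2 * (1 / 2 - n / (d : ℝ) ^ 2) * ∑ s ∈ Finset.range (2 * n - d), centralCoeff s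
      ≤ blockTrace 2 n := by
  rw [blockTrace_two]
  set P := Finset.range n ×ˢ Finset.range n with hP
  calc _ = ∑ s ∈ Finset.range (2 * n - d),
        1 / 2 * centralCoeff s * (1 / 2 - n / (d : ℝ) ^ 2) := by
        rw [Finset.mul_sum]
        exact Finset.sum_congr rfl fun s _ => by ring
    _ ≤ ∑ s ∈ Finset.range (2 * n - d), ∑ p ∈ P with p.1 + p.2 = s, ginibreEntry p.1 p.2 ^ 2 := by
        refine Finset.sum_le_sum fun s hs => ?_
        have hs' := Finset.mem_range.1 hs
        have h := sum_filter_choose_ge hd (by omega : s + d ≤ 2 * n)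
        have e : P.filter (fun p => p.1 + p.2 = s)
            = (Finset.HasAntidiagonal.antidiagonal s).filter (fun p => p.1 < n ∧ p.2 < n) := by
          ext p
          simp only [hP, Finset.mem_filter, Finset.mem_product, Finset.mem_range,
            Finset.HasAntidiagonal.mem_antidiagonal]
          tauto
        have hc : 0 ≤ 1 / 2 * centralCoeff s := by
          have := centralCoeff_pos s
          positivity
        refine (mul_le_mul_of_nonneg_left h hc).trans (le_of_eq ?_)
        rw [e, Finset.mul_sum]
        refine Finset.sum_congr rfl fun p hp => ?_
        have hps : p.1 + p.2 = s := by
          simpa using (Finset.mem_filter.1 hp).1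
        rw [ginibreEntry_sq, hps]
        ring
    _ ≤ ∑ p ∈ P, ginibreEntry p.1 p.2 ^ 2 := by
        exact Finset.sum_fiberwise_le_sum_of_sum_fiber_nonneg
          fun _ _ => Finset.sum_nonneg fun _ _ => sq_nonneg _

lemma centralCoeff_le_one_div_sqrt (n : ℕ) : centralCoeff n ≤ 1 / √(n + 1) := by
  rw [← Real.sqrt_one, ← Real.sqrt_div zero_le_one, Real.sqrt_one]
  exact Real.le_sqrt_of_sq_le (centralCoeff_sq_le n)

lemma sum_range_two_mul_sub_ge {n d : ℕ} (hn : 0 < n) (hdn : d ≤ n) :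
    ∑ s ∈ Finset.range (2 * n), centralCoeff s - d / √n
      ≤ ∑ s ∈ Finset.range (2 * n - d), centralCoeff s := by
  have hn' : (0 : ℝ) < n := by exact_mod_cast hn
  have h := Finset.sum_range_add_sum_Ico (fun s => centralCoeff s) (by omega : 2 * n - d ≤ 2 * n)
  have h2 : ∑ s ∈ Finset.Ico (2 * n - d) (2 * n), centralCoeff s ≤ d / √n := by
    calc _ ≤ ∑ s ∈ Finset.Ico (2 * n - d) (2 * n), 1 / √n := by
          refine Finset.sum_le_sum fun s hs => (centralCoeff_le_one_div_sqrt s).trans ?_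
          have hs' := (Finset.mem_Ico.1 hs).1
          gcongr
          exact_mod_cast (by omega : n ≤ s + 1)
      _ = _ := by
          rw [Finset.sum_const, Nat.card_Ico, nsmul_eq_mul,
            show 2 * n - (2 * n - d) = d by omega]
          ring
  linarith

lemma tendsto_truncTrace_two_sub_blockTrace_two :
    Tendsto (fun n : ℕ => (truncTrace 2 n - blockTrace 2 n) / √n) atTop (𝓝 0) := by
  have hpi := Real.pi_pos
  set d : ℕ → ℕ := fun n => ⌈(n : ℝ) ^ (3 / 4 : ℝ)⌉₊ with hd
  have hcast := tendsto_natCast_atTop_atTop (R := ℝ)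
  have hd1 : ∀ n : ℕ, (n : ℝ) ^ (3 / 4 : ℝ) ≤ d n := fun n => Nat.le_ceil _
  have hd2 : ∀ n : ℕ, (d n : ℝ) ≤ (n : ℝ) ^ (3 / 4 : ℝ) + 1 := fun n =>
    (Nat.ceil_lt_add_one (by positivity)).le
  have hdpos : ∀ n : ℕ, 0 < n → 0 < d n := fun n hn => by
    rw [hd, Nat.ceil_pos]
    have : (0 : ℝ) < n := by exact_mod_cast hn
    positivity
  have hdle : ∀ n : ℕ, 0 < n → d n ≤ n := fun n hn => by
    rw [hd, Nat.ceil_le]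
    have : (1 : ℝ) ≤ n := by exact_mod_cast hn
    exact Real.rpow_le_self_of_one_le this (by norm_num)
  have l1 : Tendsto (fun n : ℕ => (d n : ℝ) / n) atTop (𝓝 0) := by
    have a1 : Tendsto (fun n : ℕ => (n : ℝ) ^ (-(1 / 4) : ℝ) + 1 / (n : ℝ)) atTop (𝓝 (0 + 0)) :=
      ((tendsto_rpow_neg_atTop (by norm_num)).comp hcast).add tendsto_one_div_atTop_nhds_zero_nat
    rw [add_zero] at a1
    refine squeeze_zero' (Eventually.of_forall fun n => by positivity) ?_ a1
    filter_upwards [eventually_gt_atTop 0] with n hn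
    have hn' : (0 : ℝ) < n := by exact_mod_cast hn
    rw [div_le_iff₀ hn', add_mul, one_div_mul_cancel hn'.ne', ← Real.rpow_add_one hn'.ne']
    rw [show (-(1 / 4) + 1 : ℝ) = 3 / 4 by norm_num]
    exact hd2 n
  have l2 : Tendsto (fun n : ℕ => (n : ℝ) / (d n : ℝ) ^ 2) atTop (𝓝 0) := by
    refine squeeze_zero' (Eventually.of_forall fun n => by positivity) ?_
      ((tendsto_rpow_neg_atTop (y := 1 / 2) (by norm_num)).comp hcast)
    filter_upwards [eventually_gt_atTop 0] with n hn
    have hn' : (0 : ℝ) < n := by exact_mod_cast hn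
    have hdn : (0 : ℝ) < d n := by exact_mod_cast hdpos n hn
    rw [Function.comp_apply, div_le_iff₀ (by positivity)]
    calc (n : ℝ) = (n : ℝ) ^ (-(1 / 2) : ℝ) * ((n : ℝ) ^ (3 / 4 : ℝ)) ^ 2 := by
          rw [← Real.rpow_natCast, ← Real.rpow_mul hn'.le, ← Real.rpow_add hn']
          norm_num
      _ ≤ _ := by
          gcongr
          exact hd1 n
  have l3 : Tendsto (fun n : ℕ => (∑ s ∈ Finset.range (2 * n), centralCoeff s) / √n) atTop
      (𝓝 (2 * √2 * (1 / √Real.pi))) := by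
    have h := (tendsto_sqrt_mul_centralCoeff.comp
      (tendsto_id.const_mul_atTop' (two_pos : 0 < 2) : Tendsto (fun n : ℕ => 2 * n) atTop atTop)
      ).const_mul (2 * √2)
    refine h.congr' ?_
    filter_upwards [eventually_gt_atTop 0] with n hn
    have hn' : (0 : ℝ) < √n := Real.sqrt_pos.2 (by exact_mod_cast hn)
    rw [sum_range_centralCoeff, eq_div_iff hn'.ne']
    simp only [Function.comp_apply]
    push_cast
    have e1 : √(2 : ℝ) ^ 2 = 2 := Real.sq_sqrt (by norm_num)
    have e2 : √(n : ℝ) ^ 2 = n := Real.sq_sqrt (by positivity)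
    rw [Real.sqrt_mul (by norm_num)]
    linear_combination 2 * centralCoeff (2 * n) * (√n) ^ 2 * e1 + 4 * centralCoeff (2 * n) * e2
  have l4 : Tendsto (fun n : ℕ => (∑ s ∈ Finset.range (2 * n - d n), centralCoeff s) / √n) atTop
      (𝓝 (2 * √2 * (1 / √Real.pi))) := by
    have h := l3.sub l1
    rw [sub_zero] at h
    refine tendsto_of_tendsto_of_tendsto_of_le_of_le' h l3 ?_ ?_
    · filter_upwards [eventually_gt_atTop 0] with n hn
      have hn' : (0 : ℝ) < √n := Real.sqrt_pos.2 (by exact_mod_cast hn)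
      have e2 : √(n : ℝ) ^ 2 = n := Real.sq_sqrt (by positivity)
      have h1 := sum_range_two_mul_sub_ge hn (hdle n hn)
      calc _ = (∑ s ∈ Finset.range (2 * n), centralCoeff s - d n / √n) / √n := by
            rw [sub_div, div_div, ← sq, e2]
        _ ≤ _ := by gcongr
    · refine Eventually.of_forall fun n => ?_
      refine div_le_div_of_nonneg_right ?_ (Real.sqrt_nonneg _)
      exact Finset.sum_le_sum_of_subset_of_nonneg (Finset.range_mono (Nat.sub_le _ _))
        fun s _ _ => (centralCoeff_pos s).le
  have l5 := tendsto_truncTrace (M := 2) (by norm_num)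
  have l6 := l5.sub (((tendsto_const_nhds (x := (1 / 2 : ℝ))).sub l2).const_mul (1 / 2) |>.mul l4)
  have e : 1 / √(Real.pi * (2 : ℕ)) - 1 / 2 * (1 / 2 - 0) * (2 * √2 * (1 / √Real.pi)) = 0 := by
    have e1 : √(2 : ℝ) ^ 2 = 2 := Real.sq_sqrt (by norm_num)
    have p : 0 < √Real.pi := Real.sqrt_pos.2 hpi
    rw [Nat.cast_ofNat, Real.sqrt_mul hpi.le]
    field_simp
    linarith
  rw [e] at l6
  refine squeeze_zero' (Eventually.of_forall fun n => ?_) ?_ l6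
  · exact div_nonneg (sub_nonneg.2 (blockTrace_le (by norm_num) n)) (Real.sqrt_nonneg _)
  · filter_upwards [eventually_gt_atTop 0] with n hn
    rw [← mul_div_assoc, ← sub_div]
    gcongr
    exact blockTrace_two_ge (hdpos n hn)

lemma tendsto_blockTrace {m : ℕ} (hm : 1 ≤ m) :
    Tendsto (fun n : ℕ => blockTrace m n / √n) atTop (𝓝 (1 / √(Real.pi * m))) := by
  rcases hm.eq_or_lt with rfl | hm2
  · simp_rw [blockTrace_one]
    exact tendsto_truncTrace le_rfl
  suffices h : Tendsto (fun n : ℕ => (truncTrace m n - blockTrace m n) / √n) atTop (𝓝 0) by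
    have h2 := (tendsto_truncTrace hm).sub h
    rw [sub_zero] at h2
    refine h2.congr fun n => ?_
    ring
  have hT := tendsto_truncTrace (M := (m - 1) + (m - 1)) (by omega)
  set L : ℝ := 1 / √(Real.pi * ((m - 1) + (m - 1) : ℕ)) with hL
  have hL0 : 0 ≤ L := by positivity
  rw [Metric.tendsto_atTop]
  intro η hη
  have hm0 : (0 : ℝ) < m := by exact_mod_cast (by omega : 0 < m)
  set ε : ℝ := η / (2 * (m * (L + 1))) with hε
  have hε0 : 0 < ε := by positivity
  have hlim := (((tendsto_truncTrace_two_sub_blockTrace_two.const_mul ε⁻¹).add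
    (hT.const_mul ε)).const_mul (m : ℝ))
  have hlt : (m : ℝ) * (ε⁻¹ * 0 + ε * L) < η := by
    have : (m : ℝ) * (ε⁻¹ * 0 + ε * L) = η * (L / (2 * (L + 1))) := by
      rw [hε]
      field_simp
      ring
    rw [this]
    refine mul_lt_of_lt_one_right hη ?_
    rw [div_lt_one (by positivity)]
    linarith
  obtain ⟨N, hN⟩ := eventually_atTop.1 (hlim.eventually (gt_mem_nhds hlt))
  refine ⟨N, fun n hn => ?_⟩
  have h1 := truncTrace_le_blockTrace_add hm2 n hε0
  have h2 := blockTrace_le hm n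
  rw [Real.dist_eq, sub_zero, abs_of_nonneg (div_nonneg (sub_nonneg.2 h2) (Real.sqrt_nonneg _))]
  refine lt_of_le_of_lt ?_ (hN n hn)
  calc _ ≤ (m * (ε⁻¹ * (truncTrace 2 n - blockTrace 2 n)
        + ε * truncTrace ((m - 1) + (m - 1)) n)) / √n := by
        gcongr
        linarith
    _ = _ := by ring

lemma ginibreM_apply {n : ℕ} (j k : Fin n) : ginibreM n j k = ginibreEntry j k := rfl

lemma isHermitian_ginibreM (n : ℕ) : (ginibreM n).IsHermitian := by
  ext j k
  rw [Matrix.conjTranspose_apply, star_trivial, ginibreM_apply, ginibreM_apply, ginibreEntry_comm]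

lemma ginibreKernel_ne_top (j k : ℕ) : ginibreKernel j k ≠ ⊤ := ENNReal.ofReal_ne_top

lemma truncKernelPow_ne_top (n i j k : ℕ) : truncKernelPow n i j k ≠ ⊤ := by
  induction i generalizing k with
  | zero => rw [truncKernelPow]; split_ifs <;> simp
  | succ i ih =>
    rw [truncKernelPow]
    exact ENNReal.sum_ne_top.2 fun l _ => ENNReal.mul_ne_top (ih l) (ginibreKernel_ne_top l k)

lemma ginibreM_pow_apply {n : ℕ} (m : ℕ) (j k : Fin n) :
    (ginibreM n ^ m) j k = (truncKernelPow n m j k).toReal := by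
  induction m generalizing k with
  | zero =>
    rw [pow_zero, Matrix.one_apply, truncKernelPow]
    simp only [Fin.ext_iff]
    split_ifs <;> simp
  | succ m ih =>
    rw [pow_succ, Matrix.mul_apply, truncKernelPow, ENNReal.toReal_sum fun l _ =>
      ENNReal.mul_ne_top (truncKernelPow_ne_top n m j l) (ginibreKernel_ne_top l k),
      ← Fin.sum_univ_eq_sum_range
        (fun l => (truncKernelPow n m j l * ginibreKernel l k).toReal) n]
    refine Finset.sum_congr rfl fun l _ => ?_
    rw [ih, ginibreM_apply, ENNReal.toReal_mul, ginibreKernel,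
      ENNReal.toReal_ofReal (ginibreEntry_nonneg _ _)]

lemma trace_ginibreM_pow (m n : ℕ) : (ginibreM n ^ m).trace = blockTrace m n := by
  rw [blockTrace, ENNReal.toReal_sum fun l _ => truncKernelPow_ne_top n m l l,
    ← Fin.sum_univ_eq_sum_range (fun l => (truncKernelPow n m l l).toReal) n, Matrix.trace]
  exact Finset.sum_congr rfl fun j _ => ginibreM_pow_apply m j j

lemma Matrix.IsHermitian.trace_pow_eq_sum_eigenvalues {ι : Type*} [Fintype ι] [DecidableEq ι]
    {A : Matrix ι ι ℝ} (hA : A.IsHermitian) (m : ℕ) :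
    (A ^ m).trace = ∑ i, hA.eigenvalues i ^ m := by
  conv_lhs => rw [hA.spectral_theorem, ← map_pow, Unitary.conjStarAlgAut_apply,
    Matrix.trace_mul_cycle, Unitary.coe_star_mul_self, one_mul, Matrix.diagonal_pow,
    Matrix.trace_diagonal]
  rfl

lemma Matrix.IsHermitian.det_one_sub_eq_prod_eigenvalues {ι : Type*} [Fintype ι] [DecidableEq ι]
    {A : Matrix ι ι ℝ} (hA : A.IsHermitian) :
    (1 - A).det = ∏ i, (1 - hA.eigenvalues i) := by
  have h := Matrix.eval_charpoly A 1
  rw [hA.charpoly_eq, Polynomial.eval_prod] at h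
  simpa using h.symm

lemma blockTrace_nonneg (m n : ℕ) : 0 ≤ blockTrace m n := ENNReal.toReal_nonneg

lemma blockTrace_le_exp_two_mul {m n : ℕ} (hm : 1 ≤ m) (hn : 1 ≤ n) :
    blockTrace m n ≤ Real.exp 2 * √(n + 1) / √(m + 1) :=
  (blockTrace_le hm n).trans (truncTrace_le hm hn)

lemma abs_eigenvalues_ginibreM_lt_one {n : ℕ} (i : Fin n) :
    |(isHermitian_ginibreM n).eigenvalues i| < 1 := by
  have hn : 1 ≤ n := i.pos
  by_contra! h
  have h1 : ∀ p : ℕ, 1 ≤ blockTrace (2 * (p + 1)) n := by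
    intro p
    rw [← trace_ginibreM_pow, (isHermitian_ginibreM n).trace_pow_eq_sum_eigenvalues]
    refine le_trans ?_ (Finset.single_le_sum (f := fun i =>
      (isHermitian_ginibreM n).eigenvalues i ^ (2 * (p + 1)))
      (fun j _ => (even_two_mul _).pow_nonneg _) (Finset.mem_univ i))
    rw [← (even_two_mul (p + 1)).pow_abs]
    exact one_le_pow₀ h
  have h2 : Tendsto (fun p : ℕ => Real.exp 2 * √(n + 1) / √((2 * (p + 1) : ℕ) + 1 : ℝ)) atTop
      (𝓝 0) := by
    refine tendsto_const_nhds.div_atTop (Real.tendsto_sqrt_atTop.comp ?_)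
    refine tendsto_atTop_mono (fun p : ℕ => ?_) (tendsto_natCast_atTop_atTop (R := ℝ))
    push_cast
    have : (0 : ℝ) ≤ p := p.cast_nonneg
    linarith
  have h3 := ge_of_tendsto' h2 fun p =>
    (h1 p).trans (blockTrace_le_exp_two_mul (by omega) hn)
  linarith

lemma hasSum_log_det_one_sub_ginibreM (n : ℕ) :
    HasSum (fun m : ℕ => blockTrace (m + 1) n / (m + 1))
      (-Real.log (Matrix.det (1 - ginibreM n))) := by
  set hH := isHermitian_ginibreM n
  have hlt := fun i => abs_eigenvalues_ginibreM_lt_one (n := n) i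
  have h := hasSum_sum (s := Finset.univ) fun (i : Fin n) _ =>
    Real.hasSum_pow_div_log_of_abs_lt_one (hlt i)
  rw [hH.det_one_sub_eq_prod_eigenvalues, Real.log_prod
    (fun i _ => by linarith [(abs_lt.1 (hlt i)).2]), ← Finset.sum_neg_distrib]
  refine h.congr_fun fun m => ?_
  rw [← trace_ginibreM_pow, hH.trace_pow_eq_sum_eigenvalues, Finset.sum_div]

lemma summable_nat_succ_rpow : Summable fun m : ℕ => ((m + 1 : ℕ) : ℝ) ^ (-(3 / 2) : ℝ) :=
  (summable_nat_add_iff 1).2 (Real.summable_nat_rpow.2 (by norm_num))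

lemma one_div_mul_sqrt_eq_rpow {x : ℝ} (hx : 0 < x) : 1 / (x * √x) = x ^ (-(3 / 2) : ℝ) := by
  rw [Real.rpow_neg hx.le, show (3 / 2 : ℝ) = 1 + 1 / 2 by norm_num, Real.rpow_add hx,
    Real.rpow_one, ← Real.sqrt_eq_rpow, one_div]

theorem stmt0 :
    Filter.Tendsto
      (fun n : ℕ => (1 / Real.sqrt (2 * n)) * Real.log (Matrix.det (1 - ginibreM n)))
      Filter.atTop
      (nhds (-(1 / Real.sqrt (2 * Real.pi)) * ∑' m : ℕ+, (m : ℝ) ^ (-(3 / 2) : ℝ))) := by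
  have hpi := Real.pi_pos
  have key : Tendsto (fun n : ℕ => ∑' m : ℕ, 1 / √(2 * n) * (blockTrace (m + 1) n / (m + 1))) atTop
      (𝓝 (∑' m : ℕ, 1 / √(2 * Real.pi) * ((m + 1 : ℕ) : ℝ) ^ (-(3 / 2) : ℝ))) := by
    refine tendsto_tsum_of_dominated_convergence
      (bound := fun m : ℕ => Real.exp 2 * ((m + 1 : ℕ) : ℝ) ^ (-(3 / 2) : ℝ))
      (summable_nat_succ_rpow.mul_left _) (fun m => ?_) ?_
    · have h := (tendsto_blockTrace (m := m + 1) (by omega)).mul_const (1 / (√2 * (m + 1)))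
      refine (h.congr fun n => ?_).trans (le_of_eq ?_)
      · rw [Real.sqrt_mul (by norm_num)]
        field_simp
      · rw [← one_div_mul_sqrt_eq_rpow (by positivity), Real.sqrt_mul hpi.le,
          Real.sqrt_mul (by norm_num : (0 : ℝ) ≤ 2)]
        push_cast
        congr 1
        field_simp
    · filter_upwards [eventually_ge_atTop 1] with n hn m
      have hn' : (1 : ℝ) ≤ n := by exact_mod_cast hn
      have hb := blockTrace_nonneg (m + 1) n
      have hb2 := blockTrace_le_exp_two_mul (m := m + 1) (by omega) hn
      rw [Real.norm_of_nonneg (by positivity), ← one_div_mul_sqrt_eq_rpow (by positivity)]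
      have h1 : √(n + 1 : ℝ) ≤ √(2 * n) := Real.sqrt_le_sqrt (by linarith)
      have h2 : 0 < √(2 * n : ℝ) := Real.sqrt_pos.2 (by linarith)
      have h3 : √((m + 1 : ℕ) : ℝ) ≤ √((m + 1 : ℕ) + 1 : ℝ) := Real.sqrt_le_sqrt (by linarith)
      have h4 : 0 < √((m + 1 : ℕ) : ℝ) := Real.sqrt_pos.2 (by positivity)
      calc 1 / √(2 * n) * (blockTrace (m + 1) n / (m + 1))
          ≤ 1 / √(2 * n) * (Real.exp 2 * √(2 * n) / √((m + 1 : ℕ) : ℝ) / (m + 1)) := by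
            gcongr
            refine hb2.trans ?_
            gcongr
        _ = _ := by
            push_cast
            field_simp
  have h := key.neg
  rw [tsum_mul_left, ← neg_mul] at h
  rw [tsum_pnat_eq_tsum_succ (f := fun m : ℕ => (m : ℝ) ^ (-(3 / 2) : ℝ))]
  refine h.congr fun n => ?_
  rw [tsum_mul_left, (hasSum_log_det_one_sub_ginibreM n).tsum_eq]
  ring
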